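/- arXiv:1111.1141 — 4 statements merged into one kernel-verified Lean document; each statement's English description precedes it below -/
import Mathlib

section
/- Let Γ : S_L → ℝ³ be an injective arc-length parametrization of a curve γ, let p > 2 and α > 1 - 2/p. Suppose there exist constants η > 0 and ε > 0 with ηε^α < π/2 such that for all x, y with |x - y| < ε, Γ((x,y)) ⊆ D(Γ(x), Γ(y), η|x - y|^α). Then the Menger curvature energy M_p(γ) = ∫∫∫_{S_L³} R^{-p}(Γ(x),Γ(y),Γ(z)) dx dy dz is finite. -/
open MeasureTheory Set Real ENNReal

/-- The half cone `C⁺(P, v, β) = {P + x : ∠(v, x) < β/2}`. -/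
def halfCone {n : ℕ} (P v : EuclideanSpace ℝ (Fin n)) (β : ℝ) : Set (EuclideanSpace ℝ (Fin n)) :=
  {q | InnerProductGeometry.angle v (q - P) < β / 2}

/-- The intersection `D(P,Q,β)` of the two half cones with vertices `P`, `Q`,
common axis through `P` and `Q`, and opening angle `β`. -/
def doubleCone {n : ℕ} (P Q : EuclideanSpace ℝ (Fin n)) (β : ℝ) : Set (EuclideanSpace ℝ (Fin n)) :=
  halfCone P (Q - P) β ∩ halfCone Q (P - Q) β

/-- The Menger curvature `1/R(a,b,c) = 4·H²(conv{a,b,c})/(|a-b||b-c||a-c|)`. -/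
noncomputable def mengerCurv {n : ℕ} (a b c : EuclideanSpace ℝ (Fin n)) : ℝ :=
  4 * (μH[2] (convexHull ℝ {a, b, c})).toReal / (dist a b * dist b c * dist a c)

/-- The Menger curvature energy `M_p(γ) = ∭_{S_L³} R^{-p}(Γx, Γy, Γz) dx dy dz`
of a curve parametrized by an `L`-periodic map `Γ`. -/
noncomputable def mengerEnergy (p L : ℝ) (Γ : ℝ → EuclideanSpace ℝ (Fin 3)) : ℝ≥0∞ :=
  ∫⁻ x in Set.Ico (0 : ℝ) L, ∫⁻ y in Set.Ico (0 : ℝ) L, ∫⁻ z in Set.Ico (0 : ℝ) L,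
    ENNReal.ofReal (mengerCurv (Γ x) (Γ y) (Γ z) ^ p)

abbrev E3 := EuclideanSpace ℝ (Fin 3)

lemma area0 (a b c : E3) (hle : ‖c - a‖ ≤ ‖b - a‖) :
    μH[2] (convexHull ℝ {a, b, c}) ≤ ENNReal.ofReal
      (16 * (‖b - a‖ * ‖c - a‖ * Real.sin (InnerProductGeometry.angle (b - a) (c - a)))) := by
  set u := b - a with hu
  set v := c - a with hv
  set e := ‖u‖⁻¹ • u with he
  set t := inner ℝ e v with ht
  set h := v - t • e with hh
  set g := ‖h‖⁻¹ • h with hg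
  have unit : ∀ w : E3, ‖‖w‖⁻¹ • w‖ ≤ 1 := by
    intro w
    rw [norm_smul, norm_inv, norm_norm]
    exact inv_mul_le_one
  have he1 : ‖e‖ ≤ 1 := unit u
  have hg1 : ‖g‖ ≤ 1 := unit h
  have hrec : ∀ w : E3, ‖w‖ • (‖w‖⁻¹ • w) = w := by
    intro w
    by_cases hw : w = 0
    · simp [hw]
    · rw [smul_smul, mul_inv_cancel₀ (norm_ne_zero_iff.2 hw), one_smul]
  have htv : |t| ≤ ‖u‖ := by
    refine (abs_real_inner_le_norm e v).trans ?_
    nlinarith [norm_nonneg v, norm_nonneg e]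
  let φ : (Fin 2 → ℝ) →ₗ[ℝ] E3 :=
    (LinearMap.proj 0 : (Fin 2 → ℝ) →ₗ[ℝ] ℝ).smulRight e +
      (LinearMap.proj 1 : (Fin 2 → ℝ) →ₗ[ℝ] ℝ).smulRight g
  have hφ : ∀ w, φ w = w 0 • e + w 1 • g := fun w => by simp [φ]
  have hlip : LipschitzWith 2 (fun w => a + φ w) := by
    apply LipschitzWith.of_dist_le_mul
    intro x y
    rw [dist_add_left, dist_eq_norm, ← map_sub, hφ]
    have h0 := norm_le_pi_norm (x - y) 0
    have h1 := norm_le_pi_norm (x - y) 1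
    rw [dist_eq_norm]
    calc _ ≤ ‖(x-y) 0‖ * ‖e‖ + ‖(x-y) 1‖ * ‖g‖ := by
            refine (norm_add_le _ _).trans ?_
            rw [norm_smul _ e, norm_smul _ g]
      _ ≤ ‖x-y‖ * 1 + ‖x-y‖ * 1 := by gcongr
      _ = _ := by push_cast; ring
  set S : Set (Fin 2 → ℝ) := Icc ![-‖u‖, -‖h‖] ![‖u‖, ‖h‖] with hS
  have hconv : Convex ℝ ((fun w => a + φ w) '' S) := by
    have := ((convex_Icc ![-‖u‖, -‖h‖] ![‖u‖, ‖h‖]).linear_image φ).translate a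
    rwa [image_image] at this
  have hsub : convexHull ℝ {a, b, c} ⊆ (fun w => a + φ w) '' S := by
    apply convexHull_min _ hconv
    have memS : ∀ r q : ℝ, |r| ≤ ‖u‖ → |q| ≤ ‖h‖ → ![r, q] ∈ S := by
      intro r q hr hq
      rw [abs_le] at hr hq
      constructor <;> intro i <;> fin_cases i <;> simp <;> linarith
    rintro q (rfl | rfl | rfl)
    · exact ⟨![0,0], memS 0 0 (by simp) (by simp), by simp [hφ]⟩
    · refine ⟨![‖u‖,0], memS _ 0 (by simp) (by simp), ?_⟩
      simp only [hφ]
      simp [he, hrec, hu]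
    · refine ⟨![t,‖h‖], memS _ _ htv (by simp), ?_⟩
      simp only [hφ]
      simp only [Matrix.cons_val_zero, Matrix.cons_val_one, hg, hrec, hh, hv]
      abel
  have hvol : volume S = ENNReal.ofReal (4 * (‖u‖ * ‖h‖)) := by
    rw [hS, Real.volume_Icc_pi, Fin.prod_univ_two, ← ENNReal.ofReal_mul (by simp)]
    congr 1
    simp; ring
  have hhn : ‖h‖ ≤ ‖v‖ * Real.sin (InnerProductGeometry.angle u v) := by
    have hs0 := InnerProductGeometry.sin_angle_nonneg u v
    by_cases hu0 : u = 0
    · simp [hh, he, hu0]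
    apply le_of_sq_le_sq _ (by positivity)
    have hc := InnerProductGeometry.cos_angle_mul_norm_mul_norm u v
    have hun := norm_ne_zero_iff.2 hu0
    have htc : t = ‖v‖ * Real.cos (InnerProductGeometry.angle u v) := by
      rw [ht, he, real_inner_smul_left, ← hc]
      field_simp
    have hen : ‖e‖ = 1 := by rw [he, norm_smul, norm_inv, norm_norm, inv_mul_cancel₀ hun]
    have : ‖h‖^2 = ‖v‖^2 - t^2 := by
      rw [hh, norm_sub_sq_real, real_inner_smul_right, real_inner_comm, ← ht, norm_smul, hen]
      simp; ring
    rw [this, htc]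
    have := Real.sin_sq_add_cos_sq (InnerProductGeometry.angle u v)
    apply le_of_eq
    linear_combination ‖v‖^2 * (-this)
  calc μH[2] (convexHull ℝ {a, b, c}) ≤ μH[2] ((fun w => a + φ w) '' S) := measure_mono hsub
    _ ≤ ((2:NNReal):ℝ≥0∞) ^ (2:ℝ) * μH[2] S := hlip.hausdorffMeasure_image_le (by norm_num) S
    _ = ENNReal.ofReal 4 * ENNReal.ofReal (4 * (‖u‖ * ‖h‖)) := by
        have : (μH[2] : Measure (Fin 2 → ℝ)) = volume := by
          have := hausdorffMeasure_pi_real (ι := Fin 2)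
          simpa using this
        rw [this, hvol]
        congr 1
        norm_num
    _ ≤ _ := by
        rw [← ENNReal.ofReal_mul (by norm_num)]
        apply ENNReal.ofReal_le_ofReal
        nlinarith [mul_le_mul_of_nonneg_left hhn (norm_nonneg u)]

lemma area1 (a b c : E3) :
    μH[2] (convexHull ℝ {a, b, c}) ≤ ENNReal.ofReal
      (16 * (‖b - a‖ * ‖c - a‖ * Real.sin (InnerProductGeometry.angle (b - a) (c - a)))) := by
  rcases le_total ‖c - a‖ ‖b - a‖ with h | h
  · exact area0 a b c h
  · have := area0 a c b h
    rw [InnerProductGeometry.angle_comm, mul_comm ‖c - a‖] at this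
    rwa [Set.pair_comm b c]

lemma curv_le (a b c : E3) : mengerCurv a b c ≤
    64 * Real.sin (InnerProductGeometry.angle (b - a) (c - a)) / dist b c := by
  have hs := InnerProductGeometry.sin_angle_nonneg (b - a) (c - a)
  have h1 : (μH[2] (convexHull ℝ {a, b, c})).toReal ≤
      16 * (dist a b * dist a c * Real.sin (InnerProductGeometry.angle (b - a) (c - a))) := by
    have := area1 a b c
    rw [dist_comm a b, dist_comm a c, dist_eq_norm, dist_eq_norm]
    exact ENNReal.toReal_le_of_le_ofReal (by positivity) this
  unfold mengerCurv
  by_cases hab : dist a b = 0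
  · rw [hab]; simp; positivity
  by_cases hac : dist a c = 0
  · rw [hac]; simp; positivity
  by_cases hbc : dist b c = 0
  · rw [hbc]; simp
  have := lt_of_le_of_ne dist_nonneg (Ne.symm hab)
  have := lt_of_le_of_ne dist_nonneg (Ne.symm hac)
  have := lt_of_le_of_ne dist_nonneg (Ne.symm hbc)
  rw [div_le_div_iff₀ (by positivity) (by positivity)]
  nlinarith [mul_le_mul_of_nonneg_right h1 (dist_nonneg (x := b) (y := c))]

lemma curv_nonneg (a b c : E3) : 0 ≤ mengerCurv a b c := by
  unfold mengerCurv; positivity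

lemma curv_swap12 (a b c : E3) : mengerCurv a b c = mengerCurv b a c := by
  unfold mengerCurv
  rw [Set.insert_comm, dist_comm a b]; ring_nf

lemma curv_swap23 (a b c : E3) : mengerCurv a b c = mengerCurv a c b := by
  unfold mengerCurv
  rw [Set.pair_comm b c, dist_comm b c]; ring_nf

lemma curv_le_one (a b c : E3) : mengerCurv a b c ≤ 64 / dist b c := by
  refine (curv_le a b c).trans ?_
  gcongr
  nlinarith [Real.sin_le_one (InnerProductGeometry.angle (b - a) (c - a))]

lemma curv_eq_zero_left (a c : E3) : mengerCurv a a c = 0 := by simp [mengerCurv]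
lemma curv_eq_zero_mid (a c : E3) : mengerCurv a c c = 0 := by simp [mengerCurv]
lemma curv_eq_zero_out (a c : E3) : mengerCurv a c a = 0 := by simp [mengerCurv]

/-- Curvature bound for ordered triples. -/
lemma curv_ordered {Γ : ℝ → E3} {lam η α δ : ℝ} (hlam : 0 < lam) (hη : 0 < η)
    (hb : ∀ x y : ℝ, x ≤ y → y - x < δ → lam * (y - x) ≤ dist (Γ x) (Γ y))
    (hcone : ∀ x y : ℝ, x ≤ y → y - x < δ →
      Γ '' Set.Ioo x y ⊆ doubleCone (Γ x) (Γ y) (η * (y - x) ^ α))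
    {x y z : ℝ} (hxy : x < y) (hyz : y < z) (hxz : z - x < δ) :
    mengerCurv (Γ x) (Γ y) (Γ z) ≤ 64 * η / lam * (z - x) ^ (α - 1) := by
  obtain ⟨h1, h2⟩ := hcone x z (by linarith) hxz ⟨y, ⟨hxy, hyz⟩, rfl⟩
  simp only [halfCone, mem_ofPred_eq] at h1 h2
  have hd : 0 < z - x := by linarith
  have hsin : ∀ u v : E3, InnerProductGeometry.angle u v < η * (z - x) ^ α / 2 →
      Real.sin (InnerProductGeometry.angle u v) ≤ η * (z - x) ^ α / 2 := fun u v h =>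
    (Real.sin_le (InnerProductGeometry.angle_nonneg u v)).trans h.le
  have key : ∀ D : ℝ, lam * ((z - x) / 2) ≤ D →
      64 * (η * (z - x) ^ α / 2) / D ≤ 64 * η / lam * (z - x) ^ (α - 1) := by
    intro D hD
    have : 0 < lam * ((z - x) / 2) := by positivity
    calc _ ≤ 64 * (η * (z - x) ^ α / 2) / (lam * ((z - x) / 2)) := by gcongr
      _ = _ := by
        rw [Real.rpow_sub_one hd.ne']
        field_simp
  rcases le_total (y - x) (z - y) with h | h
  · rw [curv_swap23]
    refine (curv_le _ _ _).trans ((?_ : _ ≤ 64 * (η * (z - x) ^ α / 2) / dist (Γ z) (Γ y)).trans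
      (key _ ?_))
    · gcongr; exact hsin _ _ h1
    · rw [dist_comm]
      refine le_trans ?_ (hb y z hyz.le (by linarith))
      gcongr; linarith
  · rw [curv_swap23, curv_swap12]
    refine (curv_le _ _ _).trans ((?_ : _ ≤ 64 * (η * (z - x) ^ α / 2) / dist (Γ x) (Γ y)).trans
      (key _ ?_))
    · gcongr; exact hsin _ _ h2
    · refine le_trans ?_ (hb x y hxy.le (by linarith))
      gcongr; linarith

lemma curv_pow_ordered {Γ : ℝ → E3} {lam η α δ p s : ℝ} (hlam : 0 < lam) (hη : 0 < η)
    (hp : 0 < p) (hδ : δ ≤ 1) (hs0 : 0 ≤ s) (hs : (1 - α) * p ≤ 2 * s)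
    (hb : ∀ x y : ℝ, x ≤ y → y - x < δ → lam * (y - x) ≤ dist (Γ x) (Γ y))
    (hcone : ∀ x y : ℝ, x ≤ y → y - x < δ →
      Γ '' Set.Ioo x y ⊆ doubleCone (Γ x) (Γ y) (η * (y - x) ^ α))
    {x y z a b : ℝ} (hxy : x < y) (hyz : y < z) (hxz : z - x < δ)
    (ha : 0 < a) (ha' : a ≤ z - x) (hb0 : 0 < b) (hb' : b ≤ z - x) :
    mengerCurv (Γ x) (Γ y) (Γ z) ^ p ≤ (64 * η / lam) ^ p * (a ^ (-s) * b ^ (-s)) := by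
  have hd : 0 < z - x := by linarith
  calc _ ≤ (64 * η / lam * (z - x) ^ (α - 1)) ^ p :=
        Real.rpow_le_rpow (curv_nonneg _ _ _) (curv_ordered hlam hη hb hcone hxy hyz hxz) hp.le
    _ = (64 * η / lam) ^ p * (z - x) ^ ((α - 1) * p) := by
        rw [Real.mul_rpow (by positivity) (by positivity), ← Real.rpow_mul hd.le]
    _ ≤ (64 * η / lam) ^ p * (z - x) ^ (-s + -s) := by
        gcongr ?_ * ?_
        exact Real.rpow_le_rpow_of_exponent_ge hd (by linarith) (by linarith)
    _ = (64 * η / lam) ^ p * ((z - x) ^ (-s) * (z - x) ^ (-s)) := by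
        rw [Real.rpow_add hd]
    _ ≤ _ := by
        gcongr ?_ * (?_ * ?_)
        · exact Real.rpow_le_rpow_of_nonpos ha ha' (by linarith)
        · exact Real.rpow_le_rpow_of_nonpos hb0 hb' (by linarith)

lemma curv_pow_local {Γ : ℝ → E3} {lam η α δ p s : ℝ} (hlam : 0 < lam) (hη : 0 < η)
    (hp : 0 < p) (hδ : δ ≤ 1) (hs0 : 0 ≤ s) (hs : (1 - α) * p ≤ 2 * s)
    (hb : ∀ x y : ℝ, x ≤ y → y - x < δ → lam * (y - x) ≤ dist (Γ x) (Γ y))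
    (hcone : ∀ x y : ℝ, x ≤ y → y - x < δ →
      Γ '' Set.Ioo x y ⊆ doubleCone (Γ x) (Γ y) (η * (y - x) ^ α))
    {x y z : ℝ} (hxy : |x - y| < δ / 2) (hxz : |x - z| < δ / 2) :
    mengerCurv (Γ x) (Γ y) (Γ z) ^ p ≤
      (64 * η / lam) ^ p * (|x - y| ^ (-s) * |x - z| ^ (-s)) := by
  have hz : (0 : ℝ) ^ p ≤ (64 * η / lam) ^ p * (|x - y| ^ (-s) * |x - z| ^ (-s)) := by
    rw [Real.zero_rpow hp.ne']; positivity
  have hxy2 := abs_lt.1 hxy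
  have hxz2 := abs_lt.1 hxz
  rcases eq_or_ne x y with rfl | h1
  · rwa [curv_eq_zero_left]
  rcases eq_or_ne x z with rfl | h2
  · rwa [curv_eq_zero_out]
  rcases eq_or_ne y z with rfl | h3
  · rwa [curv_eq_zero_mid]
  have ha : 0 < |x - y| := abs_pos.2 (sub_ne_zero.2 h1)
  have hc : 0 < |x - z| := abs_pos.2 (sub_ne_zero.2 h2)
  have G : ∀ {u v w : ℝ}, u < v → v < w → w - u < δ → |x - y| ≤ w - u → |x - z| ≤ w - u →
      mengerCurv (Γ u) (Γ v) (Γ w) ^ p ≤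
      (64 * η / lam) ^ p * (|x - y| ^ (-s) * |x - z| ^ (-s)) := fun huv hvw hwu h4 h5 =>
    curv_pow_ordered hlam hη hp hδ hs0 hs hb hcone huv hvw hwu ha h4 hc h5
  rcases lt_or_gt_of_ne h1 with h1 | h1 <;> rcases lt_or_gt_of_ne h2 with h2 | h2 <;>
    rcases lt_or_gt_of_ne h3 with h3 | h3
  · exact G h1 h3 (by linarith) (abs_le.2 ⟨by linarith, by linarith⟩) (abs_le.2 ⟨by linarith, by linarith⟩)
  · rw [curv_swap23]
    exact G h2 h3 (by linarith) (abs_le.2 ⟨by linarith, by linarith⟩) (abs_le.2 ⟨by linarith, by linarith⟩)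
  · linarith
  · rw [curv_swap23, curv_swap12]
    exact G h2 h1 (by linarith) (abs_le.2 ⟨by linarith, by linarith⟩) (abs_le.2 ⟨by linarith, by linarith⟩)
  · rw [curv_swap12]
    exact G h1 h2 (by linarith) (abs_le.2 ⟨by linarith, by linarith⟩) (abs_le.2 ⟨by linarith, by linarith⟩)
  · linarith
  · rw [curv_swap12, curv_swap23]
    exact G h3 h2 (by linarith) (abs_le.2 ⟨by linarith, by linarith⟩) (abs_le.2 ⟨by linarith, by linarith⟩)
  · rw [curv_swap12, curv_swap23, curv_swap12]
    exact G h3 h1 (by linarith) (abs_le.2 ⟨by linarith, by linarith⟩) (abs_le.2 ⟨by linarith, by linarith⟩)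

/-- The integrable kernel. -/
noncomputable def ker0 (L s : ℝ) : ℝ → ℝ≥0∞ :=
  (Metric.ball (0 : ℝ) (3 * L)).indicator fun t => ENNReal.ofReal (|t| ^ (-s))

/-- The periodised kernel. -/
noncomputable def kerW (L s x y : ℝ) : ℝ≥0∞ :=
  1 + ker0 L s (x - y) + ker0 L s (x - L - y) + ker0 L s (x + L - y)

lemma measurable_ker0 (L s : ℝ) : Measurable (ker0 L s) := by
  unfold ker0
  exact Measurable.indicator (by fun_prop) measurableSet_ball

lemma lintegral_ker0 (L : ℝ) {s : ℝ} (hs : s < 1) : ∫⁻ t, ker0 L s t < ⊤ := by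
  unfold ker0
  rw [lintegral_indicator measurableSet_ball]
  have : IntegrableOn (fun t : ℝ => |t| ^ (-s)) (Metric.ball (0 : ℝ) (3 * L)) := by
    refine integrableOn_ball_of_norm_le_rpow (C := 1) (α := s) ?_ ?_ ?_ ?_
    · simp
    · simpa using hs
    · filter_upwards with x
      rw [Real.norm_eq_abs, Real.norm_eq_abs, abs_of_nonneg (by positivity), one_mul]
    · exact Measurable.aestronglyMeasurable (by fun_prop)
  have := this.lintegral_lt_top
  exact this

lemma measurable_kerW (L s x : ℝ) : Measurable (kerW L s x) := by
  unfold kerW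
  have := measurable_ker0 L s
  fun_prop

lemma lintegral_kerW (L s x : ℝ) : ∫⁻ y in Set.Ico 0 L, kerW L s x y ≤
    ENNReal.ofReal L + 3 * ∫⁻ t, ker0 L s t := by
  have hm := measurable_ker0 L s
  have h : ∀ c : ℝ, ∫⁻ y in Set.Ico 0 L, ker0 L s (c - y) ≤ ∫⁻ t, ker0 L s t := fun c =>
    (setLIntegral_le_lintegral _ _).trans (lintegral_sub_left_eq_self (ker0 L s) c).le
  unfold kerW
  rw [lintegral_add_right _ (by fun_prop), lintegral_add_right _ (by fun_prop),
    lintegral_add_right _ (by fun_prop)]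
  calc _ ≤ ENNReal.ofReal L + (∫⁻ t, ker0 L s t) + (∫⁻ t, ker0 L s t) + (∫⁻ t, ker0 L s t) := by
        refine add_le_add (add_le_add (add_le_add ?_ (h _)) (h _)) (h _)
        simp
    _ = _ := by ring

lemma lintegral_triple_lt_top {L s : ℝ} (hs : s < 1) (K : ℝ≥0∞) (hK : K < ⊤)
    (F : ℝ → ℝ → ℝ → ℝ≥0∞)
    (hF : ∀ x ∈ Set.Ico 0 L, ∀ y ∈ Set.Ico 0 L, ∀ z ∈ Set.Ico 0 L,
      F x y z ≤ K * (kerW L s x y * kerW L s x z)) :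
    ∫⁻ x in Set.Ico 0 L, ∫⁻ y in Set.Ico 0 L, ∫⁻ z in Set.Ico 0 L, F x y z < ⊤ := by
  set M := ENNReal.ofReal L + 3 * ∫⁻ t, ker0 L s t with hM
  have hMt : M < ⊤ := by
    have := lintegral_ker0 L hs
    exact ENNReal.add_lt_top.2 ⟨ENNReal.ofReal_lt_top, ENNReal.mul_lt_top (by simp) this⟩
  calc _ ≤ ∫⁻ x in Set.Ico 0 L, K * (M * M) := by
        apply setLIntegral_mono (by fun_prop)
        intro x hx
        calc _ ≤ ∫⁻ y in Set.Ico 0 L, (K * M) * kerW L s x y := by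
              apply setLIntegral_mono ((measurable_kerW L s x).const_mul _)
              intro y hy
              calc _ ≤ ∫⁻ z in Set.Ico 0 L, (K * kerW L s x y) * kerW L s x z := by
                    apply setLIntegral_mono ((measurable_kerW L s x).const_mul _)
                    intro z hz
                    rw [mul_assoc]
                    exact hF x hx y hy z hz
                _ = (K * kerW L s x y) * ∫⁻ z in Set.Ico 0 L, kerW L s x z :=
                    lintegral_const_mul _ (measurable_kerW L s x)
                _ ≤ (K * kerW L s x y) * M := by gcongr; exact lintegral_kerW L s x
                _ = _ := by ring
          _ = K * M * ∫⁻ y in Set.Ico 0 L, kerW L s x y :=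
              lintegral_const_mul _ (measurable_kerW L s x)
          _ ≤ K * M * M := by gcongr; exact lintegral_kerW L s x
          _ = _ := by ring
    _ = K * (M * M) * ENNReal.ofReal L := by simp
    _ < ⊤ := ENNReal.mul_lt_top (ENNReal.mul_lt_top hK (ENNReal.mul_lt_top hMt hMt))
        ENNReal.ofReal_lt_top

/-- Choice of a representative close to `x`. -/
lemma exists_rep {L x y s : ℝ} (hL : 0 < L) (hx : x ∈ Set.Ico 0 L) (hy : y ∈ Set.Ico 0 L) :
    ∃ k : ℤ, |x - (y + k * L)| = dist (x : AddCircle L) (y : AddCircle L) ∧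
      ENNReal.ofReal (|x - (y + k * L)| ^ (-s)) ≤ kerW L s x y := by
  refine ⟨round (L⁻¹ * (x - y)), ?_, ?_⟩
  · rw [dist_eq_norm, ← AddCircle.coe_sub, AddCircle.norm_eq]
    congr 1; ring
  · set k := round (L⁻¹ * (x - y)) with hk
    have hle : |L⁻¹ * (x - y) - k| ≤ 1 / 2 := abs_sub_round _
    have hxy : |L⁻¹ * (x - y)| < 1 := by
      rw [abs_mul, abs_inv, abs_of_pos hL, inv_mul_lt_iff₀ hL, abs_lt]
      constructor <;> linarith [hx.1, hx.2, hy.1, hy.2]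
    rw [abs_le] at hle
    rw [abs_lt] at hxy
    have hk1 : (k : ℝ) < 2 := by linarith
    have hk2 : (-2 : ℝ) < k := by linarith
    have hk1 : k < 2 := by exact_mod_cast hk1
    have hk2 : -2 < k := by exact_mod_cast hk2
    have hker : ∀ t : ℝ, |t| < 3 * L → ENNReal.ofReal (|t| ^ (-s)) = ker0 L s t := by
      intro t ht
      rw [ker0, Set.indicator_of_mem]
      simpa using ht
    clear_value k
    unfold kerW
    have hcases : k = -1 ∨ k = 0 ∨ k = 1 := by omega
    have hb : |x - (y + k * L)| < 3 * L := by
      rw [abs_lt]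
      rcases hcases with rfl | rfl | rfl <;> push_cast <;>
        constructor <;> linarith [hx.1, hx.2, hy.1, hy.2]
    rw [hker _ hb]
    rcases hcases with rfl | rfl | rfl
    · rw [show x - (y + ((-1 : ℤ) : ℝ) * L) = x + L - y by push_cast; ring]
      exact le_add_self
    · rw [show x - (y + ((0 : ℤ) : ℝ) * L) = x - y by push_cast; ring, add_assoc, add_assoc]
      exact le_add_of_nonneg_of_le zero_le (le_add_of_nonneg_right zero_le)
    · rw [show x - (y + ((1 : ℤ) : ℝ) * L) = x - L - y by push_cast; ring]
      exact le_add_of_le_of_nonneg le_add_self zero_le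

lemma one_le_kerW (L s x y : ℝ) : 1 ≤ kerW L s x y := by
  unfold kerW
  rw [add_assoc, add_assoc]
  exact le_add_of_nonneg_right zero_le


/-- Let `Γ : S_L → ℝ³` be an injective bi-Lipschitz arc-length
parametrization, `p > 2`, `α > 1 - 2/p`. If there are `η, ε > 0` with
`η ε^α < π/2` such that for `|x - y| < ε` the arc `Γ((x,y))` lies in
`D(Γ(x), Γ(y), η|x-y|^α)`, then `M_p(γ) < ∞`. -/
theorem mengerEnergy_lt_top_of_cone_condition (L : ℝ) (hL : 0 < L) (p α : ℝ)
    (hp : 2 < p) (hα : 1 - 2 / p < α)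
    (Γ Γ' : ℝ → EuclideanSpace ℝ (Fin 3))
    (hper : Function.Periodic Γ L)
    (hinj : Set.InjOn Γ (Set.Ico 0 L))
    (hderiv : ∀ x, HasDerivAt Γ (Γ' x) x)
    (hunit : ∀ x, ‖Γ' x‖ = 1)
    (hbilip : ∃ lam : ℝ, 0 < lam ∧
      ∀ x y : ℝ, lam * dist (x : AddCircle L) (y : AddCircle L) ≤ ‖Γ x - Γ y‖)
    (η ε : ℝ) (hη : 0 < η) (hε : 0 < ε) (hηε : η * ε ^ α < π / 2)
    (hcone : ∀ x y : ℝ, x ≤ y → y - x < ε →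
      Γ '' Set.Ioo x y ⊆ doubleCone (Γ x) (Γ y) (η * (y - x) ^ α)) :
    mengerEnergy p L Γ < ⊤ := by
  obtain ⟨lam, hlam, hlip⟩ := hbilip
  set δ := min (min ε 1) (L / 2) with hδdef
  have hδ : 0 < δ := by positivity
  have hδε : δ ≤ ε := (min_le_left _ _).trans (min_le_left _ _)
  have hδ1 : δ ≤ 1 := (min_le_left _ _).trans (min_le_right _ _)
  have hδL : δ ≤ L / 2 := min_le_right _ _
  clear_value δ
  set s := max 0 ((1 - α) * p / 2) with hsdef
  have hp0 : 0 < p := by linarith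
  have hs0 : 0 ≤ s := le_max_left _ _
  have hs1 : (1 - α) * p ≤ 2 * s := by
    have := le_max_right 0 ((1 - α) * p / 2)
    linarith
  have hs : s < 1 := by
    refine max_lt one_pos ?_
    have : 1 - α < 2 / p := by linarith
    rw [lt_div_iff₀ hp0] at this
    linarith
  clear_value s
  have hb : ∀ x y : ℝ, x ≤ y → y - x < δ → lam * (y - x) ≤ dist (Γ x) (Γ y) := by
    intro x y hxy hd
    have h := hlip x y
    have h2 : ‖((x - y : ℝ) : AddCircle L)‖ = |x - y| :=
      (AddCircle.norm_coe_eq_abs_iff L hL.ne').2 (by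
        rw [abs_of_pos hL, abs_of_nonpos (by linarith)]; linarith)
    rw [dist_eq_norm, ← AddCircle.coe_sub, h2, abs_of_nonpos (by linarith)] at h
    rw [dist_eq_norm]
    linarith
  have hcone' : ∀ x y : ℝ, x ≤ y → y - x < δ →
      Γ '' Set.Ioo x y ⊆ doubleCone (Γ x) (Γ y) (η * (y - x) ^ α) :=
    fun x y h1 h2 => hcone x y h1 (by linarith)
  set K₁ := (64 * η / lam) ^ p with hK₁
  set K₂ := (64 / (lam * (δ / 2))) ^ p with hK₂
  have hK₁0 : 0 ≤ K₁ := by positivity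
  have hK₂0 : 0 ≤ K₂ := by positivity
  refine lintegral_triple_lt_top hs (ENNReal.ofReal (K₁ + K₂)) ENNReal.ofReal_lt_top _ ?_
  intro x hx y hy z hz
  obtain ⟨k, hk, hkW⟩ := exists_rep (s := s) hL hx hy
  obtain ⟨l, hl, hlW⟩ := exists_rep (s := s) hL hx hz
  have hfar : ∀ D : ℝ, lam * (δ / 2) ≤ D → mengerCurv (Γ x) (Γ y) (Γ z) ≤ 64 / D →
      ENNReal.ofReal (mengerCurv (Γ x) (Γ y) (Γ z) ^ p) ≤
        ENNReal.ofReal (K₁ + K₂) * (kerW L s x y * kerW L s x z) := by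
    intro D hD hc
    calc _ ≤ ENNReal.ofReal (K₁ + K₂) * (1 * 1) := by
          rw [mul_one, mul_one]
          apply ENNReal.ofReal_le_ofReal
          have : mengerCurv (Γ x) (Γ y) (Γ z) ^ p ≤ K₂ := by
            apply Real.rpow_le_rpow (curv_nonneg _ _ _) _ hp0.le
            refine hc.trans ?_
            gcongr
          linarith
      _ ≤ _ := by gcongr <;> exact one_le_kerW _ _ _ _
  by_cases h1 : dist (x : AddCircle L) (y : AddCircle L) < δ / 2
  swap
  · push Not at h1
    refine hfar (dist (Γ x) (Γ y)) ?_ ?_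
    · rw [dist_eq_norm]
      exact (mul_le_mul_of_nonneg_left h1 hlam.le).trans (hlip x y)
    · rw [curv_swap23, curv_swap12]
      exact curv_le_one _ _ _
  by_cases h2 : dist (x : AddCircle L) (z : AddCircle L) < δ / 2
  swap
  · push Not at h2
    refine hfar (dist (Γ x) (Γ z)) ?_ ?_
    · rw [dist_eq_norm]
      exact (mul_le_mul_of_nonneg_left h2 hlam.le).trans (hlip x z)
    · rw [curv_swap12]
      exact curv_le_one _ _ _
  have hy' : Γ (y + k * L) = Γ y := hper.int_mul k y
  have hz' : Γ (z + l * L) = Γ z := hper.int_mul l z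
  rw [← hk] at h1
  rw [← hl] at h2
  have hmain := curv_pow_local hlam hη hp0 hδ1 hs0 hs1 hb hcone' h1 h2
  rw [hy', hz'] at hmain
  calc _ ≤ ENNReal.ofReal (K₁ * (|x - (y + k * L)| ^ (-s) * |x - (z + l * L)| ^ (-s))) :=
        ENNReal.ofReal_le_ofReal hmain
    _ = ENNReal.ofReal K₁ * (ENNReal.ofReal (|x - (y + k * L)| ^ (-s)) *
          ENNReal.ofReal (|x - (z + l * L)| ^ (-s))) := by
        rw [ENNReal.ofReal_mul hK₁0, ENNReal.ofReal_mul (by positivity)]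
    _ ≤ _ := by
        gcongr
        linarith
end

section
/- Let p > m(m+1) and let Σ ⊆ ℝⁿ be a compact m-dimensional manifold of class C^{1,α} with α > 1 - m(m+1)/p. Then the integral Menger-type curvature energy E_p(Σ) = ∫_{Σ^{m+2}} K(x₀,...,x_{m+1})^p dH^m(x₀)···dH^m(x_{m+1}) is finite, where K(T) = H^{m+1}(conv T)/diam(T)^{m+2}. -/
open MeasureTheory Set Real ENNReal

/-- `S ⊆ ℝⁿ` is an `m`-dimensional submanifold of class `C^{1,α}`: near each point
`a ∈ S`, `S` is the graph over the (`m`-dimensional) tangent plane `T` of a map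
`f : T → T^⊥` with `f(0) = 0`, `Df(0) = 0` and `Df` `α`-Hölder continuous. -/
def IsC1AlphaSubmanifold (m : ℕ) (α : ℝ) {n : ℕ} (S : Set (EuclideanSpace ℝ (Fin n))) : Prop :=
  ∀ a ∈ S, ∃ (T : Submodule ℝ (EuclideanSpace ℝ (Fin n))) (r C : ℝ)
      (f : T → Tᗮ) (f' : T → (T →L[ℝ] Tᗮ)),
    Module.finrank ℝ T = m ∧ 0 < r ∧ 0 < C ∧
    f 0 = 0 ∧ f' 0 = 0 ∧
    (∀ x : T, HasFDerivAt f (f' x) x) ∧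
    (∀ x y : T, ‖f' x - f' y‖ ≤ C * ‖x - y‖ ^ α) ∧
    S ∩ Metric.ball a r
      = {p | ∃ x : T, p = a + (x : EuclideanSpace ℝ (Fin n))
          + ((f x : Tᗮ) : EuclideanSpace ℝ (Fin n))} ∩ Metric.ball a r

/-- The discrete curvature `K(x₀,…,x_{m+1}) = H^{m+1}(conv{x₀,…,x_{m+1}})/diam^{m+2}`. -/
noncomputable def discreteCurv {n : ℕ} (m : ℕ) (x : Fin (m + 2) → EuclideanSpace ℝ (Fin n)) : ℝ :=
  (μH[(m + 1 : ℝ)] (convexHull ℝ (Set.range x))).toReal / Metric.diam (Set.range x) ^ (m + 2)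

/-- The integral Menger-type curvature energy
`E_p(Σ) = ∫_{Σ^{m+2}} K(x₀,…,x_{m+1})^p dH^m(x₀) ⋯ dH^m(x_{m+1})`. -/
noncomputable def curvEnergy {n : ℕ} (m : ℕ) (p : ℝ) (S : Set (EuclideanSpace ℝ (Fin n))) :
    ℝ≥0∞ :=
  ∫⁻ x : Fin (m + 2) → EuclideanSpace ℝ (Fin n), ENNReal.ofReal (discreteCurv m x ^ p)
    ∂(Measure.pi fun _ => μH[(m : ℝ)].restrict S)


lemma exists_frame_aux {n : ℕ} (m : ℕ) (V : Submodule ℝ (EuclideanSpace ℝ (Fin n)))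
    (hV : Module.finrank ℝ V ≤ m) :
    ∃ b : Fin m → EuclideanSpace ℝ (Fin n), (∀ i, ‖b i‖ ≤ 1) ∧ (∀ i, b i ∈ V) ∧
      ∀ v ∈ V, v = ∑ i, inner ℝ (b i) v • b i := by
  classical
  let B := stdOrthonormalBasis ℝ V
  have hinj : Function.Injective (Fin.castLE hV) := Fin.castLE_injective hV
  refine ⟨Function.extend (Fin.castLE hV) (fun i => (B i : EuclideanSpace ℝ (Fin n))) 0,
    ?_, ?_, ?_⟩
  · intro i
    by_cases h : ∃ j, Fin.castLE hV j = i
    · obtain ⟨j, rfl⟩ := h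
      rw [hinj.extend_apply]
      have := B.orthonormal.1 j
      exact this.le
    · rw [Function.extend_apply' _ _ _ h]; simp
  · intro i
    by_cases h : ∃ j, Fin.castLE hV j = i
    · obtain ⟨j, rfl⟩ := h
      rw [hinj.extend_apply]
      exact (B j).2
    · rw [Function.extend_apply' _ _ _ h]; simp
  · intro v hv
    have h1 := congrArg (Subtype.val) (B.sum_repr' ⟨v, hv⟩)
    rw [← Fintype.sum_of_injective (Fin.castLE hV) hinj
      (fun i => inner ℝ (B i : EuclideanSpace ℝ (Fin n)) v • (B i : EuclideanSpace ℝ (Fin n)))]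
    · simpa using h1.symm
    · intro i hi
      rw [Function.extend_apply' _ _ _ (fun ⟨j, hj⟩ => hi ⟨j, hj⟩)]; simp
    · intro i
      rw [hinj.extend_apply]

lemma exists_frame {n : ℕ} (m : ℕ) (V W : Submodule ℝ (EuclideanSpace ℝ (Fin n)))
    (hV : Module.finrank ℝ V ≤ m + 1) (hW : Module.finrank ℝ W ≤ m) :
    ∃ b : Fin (m + 1) → EuclideanSpace ℝ (Fin n), (∀ i, ‖b i‖ ≤ 1) ∧ b 0 ∈ Wᗮ ∧
      ∀ v ∈ V, v = ∑ i, inner ℝ (b i) v • b i := by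
  by_cases h : V ⊓ Wᗮ = ⊥
  · have h1 := Submodule.finrank_add_finrank_le_of_disjoint (disjoint_iff.2 h)
    have h2 := W.finrank_add_finrank_orthogonal
    obtain ⟨b, hb1, hb2, hb3⟩ := exists_frame_aux m V (by omega)
    refine ⟨Fin.cons 0 b, ?_, by simp, ?_⟩
    · intro i; refine Fin.cases (by simp) (fun i => by simpa using hb1 i) i
    · intro v hv
      simpa [Fin.sum_univ_succ] using hb3 v hv
  · obtain ⟨w, hw, hw0⟩ := Submodule.exists_mem_ne_zero_of_ne_bot h
    set ν := (‖w‖⁻¹ : ℝ) • w with hν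
    have hν1 : ‖ν‖ = 1 := norm_smul_inv_norm hw0
    have hνm : ν ∈ V ⊓ Wᗮ := Submodule.smul_mem _ _ hw
    have hνν : inner ℝ ν ν = (1:ℝ) := by rw [real_inner_self_eq_norm_sq, hν1]; norm_num
    have hlt : V ⊓ (ℝ ∙ ν)ᗮ < V := by
      refine lt_of_le_of_ne inf_le_left ?_
      intro he
      have : ν ∈ V ⊓ (ℝ ∙ ν)ᗮ := by rw [he]; exact hνm.1
      have := Submodule.mem_orthogonal_singleton_iff_inner_right.1 this.2
      rw [hνν] at this; norm_num at this
    have h3 := Submodule.finrank_lt_finrank_of_lt hlt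
    obtain ⟨b, hb1, hb2, hb3⟩ := exists_frame_aux m (V ⊓ (ℝ ∙ ν)ᗮ) (by omega)
    refine ⟨Fin.cons ν b, ?_, by simpa using hνm.2, ?_⟩
    · intro i; refine Fin.cases (by simp [hν1]) (fun i => by simpa using hb1 i) i
    · intro v hv
      have h4 := hb3 (v - inner ℝ ν v • ν) ⟨Submodule.sub_mem _ hv (Submodule.smul_mem _ _ hνm.1), by
        refine Submodule.mem_orthogonal_singleton_iff_inner_right.2 ?_
        simp [inner_sub_right, inner_smul_right, hν1]⟩
      have h5 : ∀ i, inner ℝ (b i) (v - inner ℝ ν v • ν) = inner ℝ (b i) v := by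
        intro i
        have := Submodule.mem_orthogonal_singleton_iff_inner_left.1 (hb2 i).2
        simp [inner_sub_right, inner_smul_right, this]
      simp only [h5] at h4
      rw [Fin.sum_univ_succ]
      simp only [Fin.cons_zero, Fin.cons_succ]
      rw [← h4]; abel

lemma simplex_vol {n : ℕ} (m : ℕ) (W : Submodule ℝ (EuclideanSpace ℝ (Fin n)))
    (hW : Module.finrank ℝ W ≤ m) (x : Fin (m + 2) → EuclideanSpace ℝ (Fin n)) (d h : ℝ)
    (hd0 : 0 ≤ d) (hh0 : 0 ≤ h) (hd : ∀ i, ‖x i - x 0‖ ≤ d)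
    (hh : ∀ i, ∃ w ∈ W, ‖x i - x 0 - w‖ ≤ h) :
    (μH[(m + 1 : ℝ)] (convexHull ℝ (Set.range x))) ≤
      ENNReal.ofReal ((m + 1) ^ (m + 1) * 2 ^ (m + 1) * (h * d ^ m)) := by
  obtain ⟨b, hb1, hb2, hb3⟩ := exists_frame m
    (Submodule.span ℝ (Set.range fun i : Fin (m+1) => x i.succ - x 0)) W
    ((finrank_range_le_card (R := ℝ) (fun i : Fin (m+1) => x i.succ - x 0)).trans (by simp)) hW
  let L : (Fin (m+1) → ℝ) →ₗ[ℝ] EuclideanSpace ℝ (Fin n) := Fintype.linearCombination ℝ b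
  let G : (Fin (m+1) → ℝ) → EuclideanSpace ℝ (Fin n) := fun t => x 0 + L t
  let c : Fin (m+1) → ℝ := Fin.cons h (fun _ => d)
  have hG : LipschitzWith (m+1 : NNReal) G := by
    refine LipschitzWith.of_dist_le_mul fun s t => ?_
    simp only [G, dist_add_left]
    rw [dist_eq_norm, ← map_sub]
    simp only [L, Fintype.linearCombination_apply]
    calc _ ≤ ∑ i, ‖(s - t) i • b i‖ := norm_sum_le _ _
      _ ≤ ∑ i : Fin (m+1), dist s t := by
        refine Finset.sum_le_sum fun i _ => ?_
        rw [norm_smul, dist_eq_norm]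
        have := norm_le_pi_norm (s - t) i
        have := hb1 i
        have := norm_nonneg ((s-t) i)
        nlinarith [norm_nonneg (b i)]
      _ = _ := by simp
  have hsub : convexHull ℝ (Set.range x) ⊆ G '' Icc (-c) c := by
    refine convexHull_min ?_ ?_
    · rintro _ ⟨i, rfl⟩
      have hv : x i - x 0 ∈ Submodule.span ℝ (Set.range fun i : Fin (m+1) => x i.succ - x 0) := by
        refine Fin.cases (by simp) (fun j => ?_) i
        exact Submodule.subset_span ⟨j, rfl⟩
      refine ⟨fun j => inner ℝ (b j) (x i - x 0), ?_, ?_⟩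
      · have key : ∀ j, |inner ℝ (b j) (x i - x 0)| ≤ c j := by
          intro j
          refine Fin.cases ?_ (fun j => ?_) j
          · obtain ⟨w, hw, hwh⟩ := hh i
            have h0 : inner ℝ (b 0) w = 0 := Submodule.inner_left_of_mem_orthogonal hw hb2
            have h1 : inner ℝ (b 0) (x i - x 0) = inner ℝ (b 0) (x i - x 0 - w) := by
              rw [inner_sub_right (b 0) (x i - x 0) w, h0, sub_zero]
            rw [h1]
            refine (abs_real_inner_le_norm _ _).trans ?_
            have := mul_le_mul (hb1 0) hwh (norm_nonneg _) zero_le_one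
            simpa [c] using this
          · refine (abs_real_inner_le_norm _ _).trans ?_
            have := mul_le_mul (hb1 j.succ) (hd i) (norm_nonneg _) zero_le_one
            simpa [c] using this
        exact ⟨fun j => (abs_le.1 (key j)).1, fun j => (abs_le.1 (key j)).2⟩
      · simp only [G, L, Fintype.linearCombination_apply]
        rw [← hb3 _ hv]; abel
    · have : G '' Icc (-c) c = (fun y => x 0 + y) '' (L '' Icc (-c) c) := by
        rw [Set.image_image]
      rw [this]
      exact ((convex_Icc _ _).linear_image L).translate _
  have hc : ∏ i, (c i - (-c) i) = 2 ^ (m+1) * (h * d^m) := by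
    rw [Fin.prod_univ_succ]; simp [c]; ring_nf
  calc _ ≤ μH[(m + 1 : ℝ)] (G '' Icc (-c) c) := measure_mono hsub
    _ ≤ ((m+1 : NNReal) : ℝ≥0∞) ^ (m+1 : ℝ) * μH[(m + 1 : ℝ)] (Icc (-c) c) :=
      (hG.lipschitzOnWith).hausdorffMeasure_image_le (by positivity)
    _ = ((m+1 : NNReal) : ℝ≥0∞) ^ (m+1 : ℝ) * volume (Icc (-c) c) := by
      rw [← hausdorffMeasure_pi_real]; simp
    _ = _ := by
      rw [Real.volume_Icc_pi, ← ENNReal.ofReal_prod_of_nonneg, hc]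
      · rw [mul_assoc ((m + 1 : ℝ) ^ (m + 1)), ENNReal.ofReal_mul (p := (m + 1 : ℝ) ^ (m + 1)) (by positivity)]
        congr 1
        rw [ENNReal.ofReal_pow (by positivity)]
        have e1 : ENNReal.ofReal ((m : ℝ) + 1) = ((m + 1 : ℕ) : ℝ≥0∞) := by
          rw [← ENNReal.ofReal_natCast]; push_cast; rfl
        rw [e1]
        norm_cast
      · intro i _
        refine Fin.cases ?_ (fun j => ?_) i <;> simp [c] <;> linarith


lemma proj_add {n : ℕ} (T : Submodule ℝ (EuclideanSpace ℝ (Fin n))) (x : T) (w : Tᗮ) :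
    T.orthogonalProjectionOnto ((x : EuclideanSpace ℝ (Fin n)) + w) = x := by
  rw [map_add, Submodule.orthogonalProjectionOnto_mem_subspace_eq_self,
    Submodule.orthogonalProjectionOnto_eq_zero_iff.2 w.2, add_zero]

lemma norm_le_add {n : ℕ} (T : Submodule ℝ (EuclideanSpace ℝ (Fin n))) (x : T) (w : Tᗮ) :
    ‖x‖ ≤ ‖(x : EuclideanSpace ℝ (Fin n)) + w‖ := by
  conv_lhs => rw [← proj_add T x w]
  refine (T.orthogonalProjectionOnto.le_opNorm _).trans ?_
  have := T.orthogonalProjectionOnto_norm_le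
  nlinarith [norm_nonneg ((x : EuclideanSpace ℝ (Fin n)) + w)]

/-- Upper density bound in a chart. -/
lemma density_chart {n : ℕ} (m : ℕ) (α : ℝ) (hα : 0 < α)
    (a : EuclideanSpace ℝ (Fin n)) (T : Submodule ℝ (EuclideanSpace ℝ (Fin n))) (r C : ℝ)
    (f : T → Tᗮ) (f' : T → (T →L[ℝ] Tᗮ)) (hT : Module.finrank ℝ T = m) (hr : 0 < r) (hC : 0 < C)
    (hf'0 : f' 0 = 0) (hf : ∀ x : T, HasFDerivAt f (f' x) x)
    (hf' : ∀ x y : T, ‖f' x - f' y‖ ≤ C * ‖x - y‖ ^ α)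
    (s : Set (EuclideanSpace ℝ (Fin n)))
    (hs : s ⊆ {p | ∃ x : T, p = a + (x : EuclideanSpace ℝ (Fin n))
          + ((f x : Tᗮ) : EuclideanSpace ℝ (Fin n))} ∩ Metric.ball a r) :
    ∃ A : ℝ, 0 ≤ A ∧ ∀ z ρ, 0 ≤ ρ → μH[(m : ℝ)] (s ∩ Metric.closedBall z ρ) ≤
      ENNReal.ofReal (A * ρ ^ m) := by
  let e : T ≃L[ℝ] (Fin m → ℝ) := ContinuousLinearEquiv.ofFinrankEq (by simpa using hT)
  let F : T → EuclideanSpace ℝ (Fin n) := fun x =>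
    a + (x : EuclideanSpace ℝ (Fin n)) + ((f x : Tᗮ) : EuclideanSpace ℝ (Fin n))
  let K : NNReal := ⟨1 + C * r ^ α, by positivity⟩
  have hF : LipschitzOnWith K F (Metric.ball 0 r) := by
    refine LipschitzOnWith.of_dist_le_mul fun x hx y hy => ?_
    have h1 : ‖f x - f y‖ ≤ C * r ^ α * ‖x - y‖ := by
      refine (convex_ball (0 : T) r).norm_image_sub_le_of_norm_hasFDerivWithin_le
        (f' := f') (fun u _ => (hf u).hasFDerivWithinAt) ?_ hy hx
      intro u hu
      have := hf' u 0
      rw [hf'0, sub_zero, sub_zero] at this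
      refine this.trans ?_
      have : ‖u‖ ≤ r := by simpa using (Metric.mem_ball.1 hu).le
      gcongr
    have h2 : F x - F y = ((x - y : T) : EuclideanSpace ℝ (Fin n)) +
        ((f x - f y : Tᗮ) : EuclideanSpace ℝ (Fin n)) := by
      simp only [F, Submodule.coe_sub]; abel
    rw [dist_eq_norm, dist_eq_norm, h2]
    refine (norm_add_le _ _).trans ?_
    rw [Submodule.norm_coe, Submodule.norm_coe]
    change _ ≤ (1 + C * r ^ α) * _
    linarith
  let g : (Fin m → ℝ) → EuclideanSpace ℝ (Fin n) := F ∘ e.symm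
  let D : Set (Fin m → ℝ) := e.symm ⁻¹' (Metric.ball 0 r)
  let L1 : NNReal := K * ‖(e.symm : (Fin m → ℝ) →L[ℝ] T)‖₊
  have hg : LipschitzOnWith L1 g D :=
    hF.comp (e.symm : (Fin m → ℝ) →L[ℝ] T).lipschitz.lipschitzOnWith (mapsTo_preimage _ _)
  let Q : EuclideanSpace ℝ (Fin n) →L[ℝ] (Fin m → ℝ) :=
    (e : T →L[ℝ] (Fin m → ℝ)).comp T.orthogonalProjectionOnto
  refine ⟨L1 ^ m * (2 * ‖Q‖) ^ m, by positivity, fun z ρ hρ => ?_⟩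
  have hsub : s ∩ Metric.closedBall z ρ ⊆
      g '' (D ∩ Metric.closedBall (Q (z - a)) (‖Q‖ * ρ)) := by
    rintro y ⟨hy, hyz⟩
    obtain ⟨⟨x, hx⟩, hya⟩ := hs hy
    have hya' : y - a = (x : EuclideanSpace ℝ (Fin n)) + ((f x : Tᗮ) : EuclideanSpace ℝ (Fin n)) := by
      rw [hx]; abel
    have hQ : Q (y - a) = e x := by
      simp only [Q, ContinuousLinearMap.comp_apply, hya', proj_add]; rfl
    refine ⟨e x, ⟨?_, ?_⟩, ?_⟩
    · simp only [D, mem_preimage, e.symm_apply_apply, mem_ball_zero_iff]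
      refine (norm_le_add T x (f x)).trans_lt ?_
      rw [← hya', ← dist_eq_norm]; exact hya
    · rw [Metric.mem_closedBall, ← hQ, dist_eq_norm, ← map_sub]
      refine (Q.le_opNorm _).trans ?_
      have : y - a - (z - a) = y - z := by abel
      rw [this, ← dist_eq_norm]
      gcongr
      exact hyz
    · simp [g, F, hx]
  calc _ ≤ μH[(m : ℝ)] (g '' (D ∩ Metric.closedBall (Q (z - a)) (‖Q‖ * ρ))) := measure_mono hsub
    _ ≤ (L1 : ℝ≥0∞) ^ (m : ℝ) * μH[(m : ℝ)] (D ∩ Metric.closedBall (Q (z - a)) (‖Q‖ * ρ)) :=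
      (hg.mono inter_subset_left).hausdorffMeasure_image_le (by positivity)
    _ ≤ (L1 : ℝ≥0∞) ^ (m : ℝ) * μH[(m : ℝ)] (Metric.closedBall (Q (z - a)) (‖Q‖ * ρ)) := by
      gcongr; exact inter_subset_right
    _ = (L1 : ℝ≥0∞) ^ (m : ℝ) * volume (Metric.closedBall (Q (z - a)) (‖Q‖ * ρ)) := by
      rw [← hausdorffMeasure_pi_real]; simp
    _ = _ := by
      rw [Real.volume_pi_closedBall _ (by positivity), Fintype.card_fin, mul_assoc,
        ENNReal.ofReal_mul (by positivity), ← mul_pow, ← mul_assoc, ENNReal.rpow_natCast,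
        ENNReal.ofReal_pow (by positivity) m, ENNReal.ofReal_pow (p := (L1 : ℝ)) (by positivity) m,
        ENNReal.ofReal_coe_nnreal]

/-- Volume bound in a chart (flatness). -/
lemma flat_chart {n : ℕ} (m : ℕ) (α : ℝ) (hα : 0 < α)
    (a : EuclideanSpace ℝ (Fin n)) (T : Submodule ℝ (EuclideanSpace ℝ (Fin n))) (C : ℝ)
    (f : T → Tᗮ) (f' : T → (T →L[ℝ] Tᗮ)) (hT : Module.finrank ℝ T = m) (hC : 0 < C)
    (hf : ∀ x : T, HasFDerivAt f (f' x) x)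
    (hf' : ∀ x y : T, ‖f' x - f' y‖ ≤ C * ‖x - y‖ ^ α)
    (ι : Type*) (x : ι → EuclideanSpace ℝ (Fin n)) (i0 : ι)
    (hx : ∀ i, ∃ u : T, x i = a + (u : EuclideanSpace ℝ (Fin n))
          + ((f u : Tᗮ) : EuclideanSpace ℝ (Fin n))) (d : ℝ)
    (hd : ∀ i, ‖x i - x i0‖ ≤ d) :
    ∃ W : Submodule ℝ (EuclideanSpace ℝ (Fin n)), Module.finrank ℝ W ≤ m ∧
      ∀ i, ∃ w ∈ W, ‖x i - x i0 - w‖ ≤ C * d ^ (1 + α) := by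
  choose u hu using hx
  let Φ : T →ₗ[ℝ] EuclideanSpace ℝ (Fin n) :=
    T.subtype + Tᗮ.subtype ∘ₗ (f' (u i0) : T →ₗ[ℝ] Tᗮ)
  refine ⟨LinearMap.range Φ, (LinearMap.finrank_range_le Φ).trans hT.le, fun i => ?_⟩
  refine ⟨Φ (u i - u i0), ⟨_, rfl⟩, ?_⟩
  have hdiff : x i - x i0 = ((u i - u i0 : T) : EuclideanSpace ℝ (Fin n)) +
      ((f (u i) - f (u i0) : Tᗮ) : EuclideanSpace ℝ (Fin n)) := by
    rw [hu i, hu i0, Submodule.coe_sub, Submodule.coe_sub]; abel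
  have hud : ‖u i - u i0‖ ≤ d := by
    refine le_trans ?_ (hd i)
    rw [hdiff]; exact norm_le_add T _ _
  have hd0 : 0 ≤ d := (norm_nonneg _).trans hud
  have h1 : x i - x i0 - Φ (u i - u i0) =
      ((f (u i) - f (u i0) - f' (u i0) (u i - u i0) : Tᗮ) : EuclideanSpace ℝ (Fin n)) := by
    rw [hdiff]
    simp only [Φ, LinearMap.add_apply, Submodule.subtype_apply, LinearMap.comp_apply,
      ContinuousLinearMap.coe_coe, Submodule.coe_sub]
    abel
  rw [h1, Submodule.norm_coe]
  have h2 : ‖f (u i) - f (u i0) - f' (u i0) (u i - u i0)‖ ≤ (C * d ^ α) * ‖u i - u i0‖ := by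
    refine (convex_closedBall (u i0) d).norm_image_sub_le_of_norm_hasFDerivWithin_le'
        (f' := f') (fun v _ => (hf v).hasFDerivWithinAt) ?_ (Metric.mem_closedBall_self hd0) ?_
    · intro v hv
      refine (hf' v (u i0)).trans ?_
      have : ‖v - u i0‖ ≤ d := by simpa [dist_eq_norm] using hv
      gcongr
    · simpa [dist_eq_norm] using hud
  refine h2.trans ?_
  rw [Real.rpow_add_of_nonneg hd0 zero_le_one hα.le, Real.rpow_one]
  calc _ ≤ C * d ^ α * d := by gcongr
    _ = _ := by ring

lemma riesz_bound {n : ℕ} (m : ℕ) (μ : Measure (EuclideanSpace ℝ (Fin n))) [IsFiniteMeasure μ]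
    (A : ℝ)
    (hμ : ∀ z ρ, 0 ≤ ρ → μ (Metric.closedBall z ρ) ≤ ENNReal.ofReal (A * ρ ^ m))
    (s : ℝ) (hs0 : 0 ≤ s) (hsm : s < m) :
    ∃ M : ℝ≥0∞, M < ⊤ ∧ ∀ z, ∫⁻ y, edist y z ^ (-s) ∂μ ≤ M := by
  rcases hs0.eq_or_lt with rfl | hs
  · exact ⟨μ univ, measure_lt_top _ _, fun z => by simp⟩
  let w : ℕ → ℝ := fun k => ((1 / 2 : ℝ) ^ (k + 1)) ^ (-s)
  have hw : ∀ k, 1 ≤ w k := fun k => by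
    refine Real.one_le_rpow_of_pos_of_le_one_of_nonpos (by positivity)
      (pow_le_one₀ (by norm_num) (by norm_num)) (by linarith)
  have hpt : ∀ z y : EuclideanSpace ℝ (Fin n), edist y z ^ (-s) ≤ 1 + ∑' k : ℕ,
      (Metric.closedBall z ((1/2 : ℝ)^k)).indicator (fun _ => ENNReal.ofReal (w k)) y := by
    intro z y
    rcases (dist_nonneg (x := y) (y := z)).eq_or_lt with h0 | h0
    · have : y = z := dist_eq_zero.1 h0.symm
      subst this
      have : ∑' k : ℕ, (Metric.closedBall y ((1/2 : ℝ)^k)).indicator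
          (fun _ => ENNReal.ofReal (w k)) y = ⊤ := by
        rw [eq_top_iff, ← ENNReal.tsum_const_eq_top_of_ne_zero (α := ℕ) (one_ne_zero (α := ℝ≥0∞))]
        refine ENNReal.tsum_le_tsum fun k => ?_
        rw [indicator_of_mem (Metric.mem_closedBall_self (by positivity))]
        rw [← ENNReal.ofReal_one]; exact ENNReal.ofReal_le_ofReal (hw k)
      rw [this]; simp
    · rcases le_or_gt (dist y z) 1 with h1 | h1
      · obtain ⟨k, hk1, hk2⟩ := exists_nat_pow_near_of_lt_one h0 h1
          (by norm_num : (0:ℝ) < 1/2) (by norm_num)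
        refine le_trans ?_ le_add_self
        refine le_trans ?_ (ENNReal.le_tsum k)
        rw [indicator_of_mem (Metric.mem_closedBall.2 hk2), edist_dist,
          ENNReal.ofReal_rpow_of_pos h0]
        refine ENNReal.ofReal_le_ofReal ?_
        exact Real.rpow_le_rpow_of_nonpos (by positivity) hk1.le (by linarith)
      · refine le_trans ?_ le_self_add
        rw [edist_dist, ENNReal.ofReal_rpow_of_pos h0, ← ENNReal.ofReal_one]
        refine ENNReal.ofReal_le_ofReal ?_
        exact Real.rpow_le_one_of_one_le_of_nonpos h1.le (by linarith)
  let q : ℝ := (1/2 : ℝ) ^ ((m : ℝ) - s)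
  have hq1 : q < 1 := Real.rpow_lt_one (by norm_num) (by norm_num) (by linarith)
  have hterm : ∀ k, w k * (A * ((1/2 : ℝ)^k) ^ m) = (A * (1/2 : ℝ) ^ (-s)) * q ^ k := by
    intro k
    simp only [w, q]
    rw [← Real.rpow_natCast (((1/2 : ℝ)^k)) m, ← Real.rpow_natCast (1/2) k,
      ← Real.rpow_natCast (1/2) (k+1), ← Real.rpow_natCast _ k, ← Real.rpow_mul (by norm_num),
      ← Real.rpow_mul (by norm_num), ← Real.rpow_mul (by norm_num)]
    have : ((1/2 : ℝ) ^ (((k+1 : ℕ) : ℝ) * -s)) * ((1/2 : ℝ) ^ ((k:ℝ) * m)) =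
      (1/2 : ℝ) ^ (-s) * (1/2 : ℝ) ^ (((m:ℝ) - s) * k) := by
      rw [← Real.rpow_add (by norm_num), ← Real.rpow_add (by norm_num)]
      congr 1; push_cast; ring
    linear_combination A * this
  have hsum : Summable fun k : ℕ => (A * (1/2 : ℝ) ^ (-s)) * q ^ k :=
    (summable_geometric_of_lt_one (by positivity) hq1).mul_left _
  refine ⟨μ univ + ∑' k, ENNReal.ofReal ((A * (1/2 : ℝ) ^ (-s)) * q ^ k),
    ENNReal.add_lt_top.2 ⟨measure_lt_top _ _, hsum.tsum_ofReal_lt_top⟩, fun z => ?_⟩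
  refine (lintegral_mono (hpt z)).trans ?_
  rw [lintegral_add_left measurable_const, lintegral_one, lintegral_tsum]
  · gcongr with k
    rw [lintegral_indicator_const Metric.isClosed_closedBall.measurableSet, ← hterm,
      ENNReal.ofReal_mul (by linarith [hw k])]
    gcongr
    exact hμ z _ (by positivity)
  · intro k
    exact (measurable_const.indicator Metric.isClosed_closedBall.measurableSet).aemeasurable

lemma lintegral_pi_prod {X : Type*} [MeasurableSpace X] (μ : Measure X) [IsFiniteMeasure μ]
    (f : X → ℝ≥0∞) (hf : Measurable f) (k : ℕ) :
    ∫⁻ x : Fin k → X, ∏ i, f (x i) ∂(Measure.pi fun _ => μ) ≤ (∫⁻ y, f y ∂μ) ^ k := by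
  induction k with
  | zero => simp
  | succ k ih =>
    have h := (measurePreserving_piFinSuccAbove (fun _ : Fin (k+1) => μ) 0).symm
    rw [← h.lintegral_comp_emb (MeasurableEquiv.measurableEmbedding _)]
    refine (lintegral_prod_le _).trans ?_
    simp only [MeasurableEquiv.piFinSuccAbove_symm_apply, Fin.insertNthEquiv,
            Fin.prod_univ_succ, Fin.insertNth_zero, Equiv.coe_fn_mk, Fin.cons_succ,
            Fin.zero_succAbove, cast_eq, Fin.cons_zero]
    have : ∀ x : X, ∫⁻ y : Fin k → X, f x * ∏ i, f (y i) ∂(Measure.pi fun _ => μ) ≤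
        f x * (∫⁻ y, f y ∂μ) ^ k := by
      intro x
      rw [lintegral_const_mul _ (by fun_prop)]
      gcongr
    refine (lintegral_mono this).trans ?_
    rw [lintegral_mul_const _ hf, pow_succ']

lemma lintegral_star {n : ℕ} (μ : Measure (EuclideanSpace ℝ (Fin n))) [IsFiniteMeasure μ]
    (s : ℝ) (M : ℝ≥0∞) (hM : M < ⊤) (h : ∀ z, ∫⁻ y, edist y z ^ (-s) ∂μ ≤ M) (k : ℕ) :
    ∫⁻ x : Fin (k + 1) → EuclideanSpace ℝ (Fin n), ∏ i : Fin k, edist (x i.succ) (x 0) ^ (-s)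
      ∂(Measure.pi fun _ => μ) < ⊤ := by
  have hp := (measurePreserving_piFinSuccAbove (fun _ : Fin (k+1) => μ) 0).symm
  rw [← hp.lintegral_comp_emb (MeasurableEquiv.measurableEmbedding _)]
  refine (lintegral_prod_le _).trans_lt ?_
  simp only [MeasurableEquiv.piFinSuccAbove_symm_apply, Fin.insertNthEquiv,
            Fin.insertNth_zero, Equiv.coe_fn_mk, Fin.cons_succ,
            Fin.zero_succAbove, cast_eq, Fin.cons_zero]
  have : ∀ x : EuclideanSpace ℝ (Fin n), ∫⁻ y : Fin k → EuclideanSpace ℝ (Fin n),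
      ∏ i, edist (y i) x ^ (-s) ∂(Measure.pi fun _ => μ) ≤ M ^ k := by
    intro x
    refine (lintegral_pi_prod μ (fun y => edist y x ^ (-s)) (by fun_prop) k).trans ?_
    gcongr
    exact h x
  refine (lintegral_mono this).trans_lt ?_
  rw [lintegral_const]
  exact ENNReal.mul_lt_top (ENNReal.pow_lt_top hM) (measure_lt_top _ _)

lemma density_global {n : ℕ} (m : ℕ) (α : ℝ) (hα : 0 < α) (S : Set (EuclideanSpace ℝ (Fin n)))
    (hcomp : IsCompact S) (hmfld : IsC1AlphaSubmanifold m α S) :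
    ∃ A : ℝ, 0 ≤ A ∧ ∀ z ρ, 0 ≤ ρ → μH[(m : ℝ)] (S ∩ Metric.closedBall z ρ) ≤
      ENNReal.ofReal (A * ρ ^ m) := by
  refine hcomp.induction_on (p := fun s => ∃ A : ℝ, 0 ≤ A ∧ ∀ z ρ, 0 ≤ ρ →
    μH[(m : ℝ)] (s ∩ Metric.closedBall z ρ) ≤ ENNReal.ofReal (A * ρ ^ m)) ?_ ?_ ?_ ?_
  · exact ⟨0, le_rfl, by simp⟩
  · rintro s t hst ⟨A, hA, h⟩
    exact ⟨A, hA, fun z ρ hρ => (measure_mono (inter_subset_inter_left _ hst)).trans (h z ρ hρ)⟩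
  · rintro s t ⟨A, hA, h⟩ ⟨B, hB, h'⟩
    refine ⟨A + B, by positivity, fun z ρ hρ => ?_⟩
    rw [union_inter_distrib_right, add_mul, ENNReal.ofReal_add (by positivity) (by positivity)]
    exact (measure_union_le _ _).trans (add_le_add (h z ρ hρ) (h' z ρ hρ))
  · intro a ha
    obtain ⟨T, r, C, f, f', hT, hr, hC, hf0, hf'0, hf, hf', hS⟩ := hmfld a ha
    exact ⟨S ∩ Metric.ball a r,
      Filter.inter_mem self_mem_nhdsWithin (mem_nhdsWithin_of_mem_nhds (Metric.ball_mem_nhds a hr)),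
      density_chart m α hα a T r C f f' hT hr hC hf'0 hf hf' _ hS.le⟩

lemma norm_sub_le_diam {n k : ℕ} (x : Fin k → EuclideanSpace ℝ (Fin n)) (i j : Fin k) :
    ‖x i - x j‖ ≤ Metric.diam (Set.range x) := by
  rw [← dist_eq_norm]
  exact Metric.dist_le_diam_of_mem (Set.finite_range x).isBounded ⟨i, rfl⟩ ⟨j, rfl⟩

lemma flat_global {n : ℕ} (m : ℕ) (α : ℝ) (hα : 0 < α) (S : Set (EuclideanSpace ℝ (Fin n)))
    (hcomp : IsCompact S) (hmfld : IsC1AlphaSubmanifold m α S) :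
    ∃ C δ : ℝ, 0 ≤ C ∧ 0 < δ ∧ ∀ x : Fin (m + 2) → EuclideanSpace ℝ (Fin n), (∀ i, x i ∈ S) →
      Metric.diam (Set.range x) < δ → (μH[(m + 1 : ℝ)] (convexHull ℝ (Set.range x))).toReal ≤
      C * (Metric.diam (Set.range x) ^ (1 + α) * Metric.diam (Set.range x) ^ m) := by
  suffices H : ∃ C δ : ℝ, 0 ≤ C ∧ 0 < δ ∧ ∀ x : Fin (m + 2) → EuclideanSpace ℝ (Fin n),
      (∀ i, x i ∈ S) → x 0 ∈ S →
      Metric.diam (Set.range x) < δ → (μH[(m + 1 : ℝ)] (convexHull ℝ (Set.range x))).toReal ≤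
      C * (Metric.diam (Set.range x) ^ (1 + α) * Metric.diam (Set.range x) ^ m) by
    obtain ⟨C, δ, hC, hδ, h⟩ := H
    exact ⟨C, δ, hC, hδ, fun x hx => h x hx (hx 0)⟩
  refine hcomp.induction_on (p := fun s => ∃ C δ : ℝ, 0 ≤ C ∧ 0 < δ ∧
      ∀ x : Fin (m + 2) → EuclideanSpace ℝ (Fin n),
      (∀ i, x i ∈ S) → x 0 ∈ s →
      Metric.diam (Set.range x) < δ → (μH[(m + 1 : ℝ)] (convexHull ℝ (Set.range x))).toReal ≤
      C * (Metric.diam (Set.range x) ^ (1 + α) * Metric.diam (Set.range x) ^ m)) ?_ ?_ ?_ ?_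
  · exact ⟨0, 1, le_rfl, one_pos, by simp⟩
  · rintro s t hst ⟨C, δ, hC, hδ, h⟩
    exact ⟨C, δ, hC, hδ, fun x hx hx0 => h x hx (hst hx0)⟩
  · rintro s t ⟨C, δ, hC, hδ, h⟩ ⟨C', δ', hC', hδ', h'⟩
    refine ⟨max C C', min δ δ', le_max_of_le_left hC, lt_min hδ hδ', fun x hx hx0 hd => ?_⟩
    have hnn : 0 ≤ Metric.diam (Set.range x) ^ (1 + α) * Metric.diam (Set.range x) ^ m := by
      have := Metric.diam_nonneg (s := Set.range x)
      positivity
    rcases hx0 with h0 | h0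
    · exact (h x hx h0 (hd.trans_le (min_le_left _ _))).trans
        (mul_le_mul_of_nonneg_right (le_max_left _ _) hnn)
    · exact (h' x hx h0 (hd.trans_le (min_le_right _ _))).trans
        (mul_le_mul_of_nonneg_right (le_max_right _ _) hnn)
  · intro a ha
    obtain ⟨T, r, C, f, f', hT, hr, hC, hf0, hf'0, hf, hf', hS⟩ := hmfld a ha
    refine ⟨S ∩ Metric.ball a (r/2), Filter.inter_mem self_mem_nhdsWithin
      (mem_nhdsWithin_of_mem_nhds (Metric.ball_mem_nhds a (by positivity))),
      (m + 1) ^ (m + 1) * 2 ^ (m + 1) * C, r / 2, by positivity, by positivity,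
      fun x hx hx0 hd => ?_⟩
    have hD := Metric.diam_nonneg (s := Set.range x)
    have hmem : ∀ i, ∃ u : T, x i = a + (u : EuclideanSpace ℝ (Fin n))
          + ((f u : Tᗮ) : EuclideanSpace ℝ (Fin n)) := by
      intro i
      have : x i ∈ S ∩ Metric.ball a r := by
        refine ⟨hx i, ?_⟩
        rw [Metric.mem_ball]
        have h1 := norm_sub_le_diam x i 0
        rw [← dist_eq_norm] at h1
        have h2 := Metric.mem_ball.1 hx0.2
        linarith [dist_triangle (x i) (x 0) a]
      rw [hS] at this
      exact this.1
    obtain ⟨W, hW, hWx⟩ := flat_chart m α hα a T C f f' hT hC hf hf' (Fin (m+2)) x 0 hmem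
      (Metric.diam (Set.range x)) (fun i => norm_sub_le_diam x i 0)
    have := simplex_vol m W hW x _ _ hD (by positivity) (fun i => norm_sub_le_diam x i 0) hWx
    refine (ENNReal.toReal_mono ENNReal.ofReal_ne_top this).trans ?_
    rw [ENNReal.toReal_ofReal (by positivity)]
    apply le_of_eq; ring

lemma curv_bound {n : ℕ} (m : ℕ) (α : ℝ) (hα : 0 < α) (S : Set (EuclideanSpace ℝ (Fin n)))
    (hcomp : IsCompact S) (hmfld : IsC1AlphaSubmanifold m α S) :
    ∃ C : ℝ, 0 ≤ C ∧ ∀ x : Fin (m + 2) → EuclideanSpace ℝ (Fin n), (∀ i, x i ∈ S) →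
      0 < Metric.diam (Set.range x) →
      discreteCurv m x ≤ C * Metric.diam (Set.range x) ^ (α - 1) := by
  obtain ⟨C, δ, hC, hδ, h⟩ := flat_global m α hα S hcomp hmfld
  set c : ℝ := (m + 1) ^ (m + 1) * 2 ^ (m + 1) with hc
  have hc0 : 0 ≤ c := by positivity
  refine ⟨max C (c * δ ^ (-α)), le_max_of_le_left hC, fun x hx hd => ?_⟩
  set D := Metric.diam (Set.range x) with hD
  have e1 : D ^ (α - 1) * D ^ (m + 2) = D ^ (1 + α) * D ^ m := by
    rw [← Real.rpow_natCast, ← Real.rpow_natCast, ← Real.rpow_add hd, ← Real.rpow_add hd]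
    congr 1; push_cast; ring
  unfold discreteCurv
  rw [div_le_iff₀ (by positivity), mul_assoc, e1]
  have hnn : 0 ≤ D ^ (1 + α) * D ^ m := by positivity
  rcases lt_or_ge D δ with h1 | h1
  · exact (h x hx h1).trans (mul_le_mul_of_nonneg_right (le_max_left _ _) hnn)
  · refine le_trans ?_ (mul_le_mul_of_nonneg_right (le_max_right _ _) hnn)
    have := simplex_vol m ⊥ (by simp) x D D hd.le hd.le (fun i => norm_sub_le_diam x i 0)
      (fun i => ⟨0, by simp, by simpa using norm_sub_le_diam x i 0⟩)
    refine (ENNReal.toReal_mono ENNReal.ofReal_ne_top this).trans ?_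
    rw [ENNReal.toReal_ofReal (by positivity), ← hc, mul_assoc c (δ ^ (-α))]
    refine mul_le_mul_of_nonneg_left ?_ hc0
    rw [← mul_assoc]
    refine mul_le_mul_of_nonneg_right ?_ (by positivity)
    have e2 : D = D ^ (-α) * D ^ (1 + α) := by
      rw [← Real.rpow_add hd]; simp
    conv_lhs => rw [e2]
    refine mul_le_mul_of_nonneg_right ?_ (by positivity)
    exact Real.rpow_le_rpow_of_nonpos hδ h1 (by linarith)

/-- If `p > m(m+1)` and `Σ ⊆ ℝⁿ` is a compact `m`-dimensional
manifold of class `C^{1,α}` with `α > 1 - m(m+1)/p`, then `E_p(Σ) < ∞`. -/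
theorem curvEnergy_lt_top_of_C1alpha (m n : ℕ) (p α : ℝ) (hm : 0 < m)
    (hp : (m : ℝ) * (m + 1) < p) (hα : 1 - (m : ℝ) * (m + 1) / p < α) (hα1 : α ≤ 1)
    (S : Set (EuclideanSpace ℝ (Fin n)))
    (hcomp : IsCompact S) (hmfld : IsC1AlphaSubmanifold m α S) :
    curvEnergy m p S < ⊤ := by
  have hp0 : 0 < p := lt_of_le_of_lt (by positivity) hp
  have hα0 : 0 < α := by
    have : (m : ℝ) * (m + 1) / p < 1 := by rwa [div_lt_one hp0]
    linarith
  obtain ⟨A, hA, hdens⟩ := density_global m α hα0 S hcomp hmfld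
  obtain ⟨C, hC, hcurv⟩ := curv_bound m α hα0 S hcomp hmfld
  set μ : Measure (EuclideanSpace ℝ (Fin n)) := μH[(m : ℝ)].restrict S with hμ
  have hμb : ∀ z ρ, 0 ≤ ρ → μ (Metric.closedBall z ρ) ≤ ENNReal.ofReal (A * ρ ^ m) := by
    intro z ρ hρ
    rw [hμ, Measure.restrict_apply Metric.isClosed_closedBall.measurableSet, inter_comm]
    exact hdens z ρ hρ
  have : IsFiniteMeasure μ := by
    refine ⟨?_⟩
    obtain ⟨R, hR⟩ := hcomp.isBounded.subset_closedBall (0 : EuclideanSpace ℝ (Fin n))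
    rw [hμ, Measure.restrict_apply_univ]
    have hR' : S ⊆ S ∩ Metric.closedBall 0 (max R 0) := fun y hy =>
      ⟨hy, Metric.closedBall_subset_closedBall (le_max_left _ _) (hR hy)⟩
    exact ((measure_mono hR').trans (hdens 0 _ (le_max_right _ _))).trans_lt ENNReal.ofReal_lt_top
  set s : ℝ := (1 - α) * p / (m + 1) with hs
  have hs0 : 0 ≤ s := by
    have : 0 ≤ 1 - α := by linarith
    positivity
  have hsm : s < m := by
    rw [hs, div_lt_iff₀ (by positivity)]
    have : 1 - α < (m : ℝ) * (m + 1) / p := by linarith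
    rwa [lt_div_iff₀ hp0] at this
  obtain ⟨M, hM, hMb⟩ := riesz_bound m μ A hμb s hs0 hsm
  have hfin := lintegral_star μ s M hM hMb (m + 1)
  have hae : ∀ᵐ x : Fin (m + 2) → EuclideanSpace ℝ (Fin n) ∂(Measure.pi fun _ => μ),
      ∀ i, x i ∈ S := by
    rw [Filter.eventually_all]
    intro i
    exact (Measure.tendsto_eval_ae_ae (μ := fun _ : Fin (m+2) => μ) (i := i)).eventually
      (ae_restrict_mem hcomp.measurableSet)
  have hbound : ∀ x : Fin (m + 2) → EuclideanSpace ℝ (Fin n), (∀ i, x i ∈ S) →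
      ENNReal.ofReal (discreteCurv m x ^ p) ≤
      ENNReal.ofReal (C ^ p) * ∏ i : Fin (m + 1), edist (x i.succ) (x 0) ^ (-s) := by
    intro x hx
    rcases (Metric.diam_nonneg (s := Set.range x)).eq_or_lt with h0 | h0
    · have : discreteCurv m x = 0 := by
        unfold discreteCurv; rw [← h0]; simp
      rw [this, Real.zero_rpow hp0.ne']; simp
    · have hK0 : 0 ≤ discreteCurv m x := by unfold discreteCurv; positivity
      have h1 : discreteCurv m x ^ p ≤ C ^ p * (Metric.diam (Set.range x) ^ (-s)) ^ (m + 1) := by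
        refine (Real.rpow_le_rpow hK0 (hcurv x hx h0) hp0.le).trans (le_of_eq ?_)
        rw [Real.mul_rpow hC (by positivity), ← Real.rpow_natCast, ← Real.rpow_mul h0.le,
          ← Real.rpow_mul h0.le]
        congr 2
        rw [hs]; push_cast; field_simp; ring
      refine (ENNReal.ofReal_le_ofReal h1).trans ?_
      rw [ENNReal.ofReal_mul (by positivity), ENNReal.ofReal_pow (by positivity)]
      gcongr
      have : ENNReal.ofReal (Metric.diam (Set.range x) ^ (-s)) ^ (m + 1) =
        ∏ i : Fin (m + 1), ENNReal.ofReal (Metric.diam (Set.range x) ^ (-s)) := by simp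
      rw [this]
      refine Finset.prod_le_prod' fun i _ => ?_
      rw [← ENNReal.ofReal_rpow_of_pos h0, ENNReal.rpow_neg, ENNReal.rpow_neg,
        ENNReal.inv_le_inv]
      refine ENNReal.rpow_le_rpow ?_ hs0
      rw [edist_dist, dist_eq_norm]
      exact ENNReal.ofReal_le_ofReal (norm_sub_le_diam x _ _)
  unfold curvEnergy
  refine (lintegral_mono_ae (hae.mono hbound)).trans_lt ?_
  rw [lintegral_const_mul' _ _ ENNReal.ofReal_ne_top]
  exact ENNReal.mul_lt_top ENNReal.ofReal_lt_top hfin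
end

section
/- Let p > 2 and α = 1 - 2/p. There exists a function F ∈ C^{1,α}(ℝ) such that the Menger curvature energy of its graph is infinite: ∫₀¹∫₀¹∫₀¹ R^{-p}((x,F(x)), (y,F(y)), (z,F(z))) dx dy dz = ∞. -/
open MeasureTheory Set Real ENNReal

/-- The point `(t, F(t)) ∈ ℝ²` on the graph of `F`. -/
noncomputable def graphPt (F : ℝ → ℝ) (t : ℝ) : EuclideanSpace ℝ (Fin 2) :=
  (EuclideanSpace.equiv (Fin 2) ℝ).symm ![t, F t]


noncomputable def FF (r : ℝ) (N : ℕ) (x : ℝ) : ℝ := ∑' k : ℕ, r ^ k * cos (2 * π * (N : ℝ) ^ k * x)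
noncomputable def GG (s : ℝ) (N : ℕ) (x : ℝ) : ℝ :=
  ∑' k : ℕ, s ^ k * (-(2 * π) * sin (2 * π * (N : ℝ) ^ k * x))

lemma FF_summable {r : ℝ} (h0 : 0 ≤ r) (h1 : r < 1) (N : ℕ) (x : ℝ) :
    Summable fun k : ℕ => r ^ k * cos (2 * π * (N : ℝ) ^ k * x) := by
  refine Summable.of_norm_bounded (summable_geometric_of_lt_one h0 h1) fun k => ?_
  rw [norm_mul, norm_pow, Real.norm_of_nonneg h0]
  exact mul_le_of_le_one_right (by positivity) (abs_cos_le_one _)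

lemma GG_term_bound {s : ℝ} (h0 : 0 ≤ s) (N k : ℕ) (x : ℝ) :
    ‖s ^ k * (-(2 * π) * sin (2 * π * (N : ℝ) ^ k * x))‖ ≤ 2 * π * s ^ k := by
  rw [norm_mul, norm_pow, Real.norm_of_nonneg h0, norm_mul, norm_neg,
    Real.norm_of_nonneg (by positivity : (0:ℝ) ≤ 2 * π), mul_comm (2 * π) (s ^ k)]
  refine mul_le_mul_of_nonneg_left ?_ (by positivity)
  exact mul_le_of_le_one_right (by positivity) (abs_sin_le_one _)

lemma GG_summable {s : ℝ} (h0 : 0 ≤ s) (h1 : s < 1) (N : ℕ) (x : ℝ) :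
    Summable fun k : ℕ => s ^ k * (-(2 * π) * sin (2 * π * (N : ℝ) ^ k * x)) :=
  Summable.of_norm_bounded ((summable_geometric_of_lt_one h0 h1).mul_left (2 * π))
    fun k => GG_term_bound h0 N k x

lemma GG_bound {s : ℝ} (h0 : 0 ≤ s) (h1 : s < 1) (N : ℕ) (x : ℝ) :
    |GG s N x| ≤ 2 * π * (1 - s)⁻¹ := by
  have := tsum_of_norm_bounded (f := fun k : ℕ => s ^ k * (-(2 * π) * sin (2 * π * (N : ℝ) ^ k * x)))
    ((hasSum_geometric_of_lt_one h0 h1).mul_left (2 * π))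
    (fun k => GG_term_bound h0 N k x)
  exact this

lemma FF_eq {r : ℝ} (h0 : 0 ≤ r) (h1 : r < 1) (N : ℕ) (x : ℝ) :
    FF r N x = cos (2 * π * x) + r * FF r N (N * x) := by
  unfold FF
  rw [(FF_summable h0 h1 N x).tsum_eq_zero_add, ← tsum_mul_left]
  congr 1
  · simp
  · congr 1; ext k; rw [pow_succ, pow_succ]; ring_nf

lemma GG_eq {s : ℝ} (h0 : 0 ≤ s) (h1 : s < 1) (N : ℕ) (x : ℝ) :
    GG s N x = -(2 * π) * sin (2 * π * x) + s * GG s N (N * x) := by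
  unfold GG
  rw [(GG_summable h0 h1 N x).tsum_eq_zero_add, ← tsum_mul_left]
  congr 1
  · simp
  · congr 1; ext k; rw [pow_succ, pow_succ]; ring_nf

lemma FF_add_nat (r : ℝ) (N : ℕ) (x : ℝ) (i : ℕ) : FF r N (x + i) = FF r N x := by
  unfold FF
  congr 1; ext k
  congr 1
  rw [← cos_add_nat_mul_two_pi (2 * π * (N : ℝ) ^ k * x) (N ^ k * i)]
  congr 1; push_cast; ring

lemma FF_hasDerivAt {r : ℝ} (N : ℕ) (h0 : 0 ≤ r) (h1 : r < 1) (hs : r * N < 1) (x : ℝ) :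
    HasDerivAt (FF r N) (GG (r * N) N x) x := by
  have hs0 : 0 ≤ r * N := by positivity
  refine hasDerivAt_tsum (u := fun k => 2 * π * (r * N) ^ k)
    (g := fun (k : ℕ) (x : ℝ) => r ^ k * cos (2 * π * (N : ℝ) ^ k * x))
    (g' := fun (k : ℕ) (x : ℝ) => (r * N) ^ k * (-(2 * π) * sin (2 * π * (N : ℝ) ^ k * x)))
    ((summable_geometric_of_lt_one hs0 hs).mul_left (2 * π)) ?_
    (fun k y => GG_term_bound hs0 N k y) (FF_summable h0 h1 N 0) x
  intro k y
  have := (((hasDerivAt_id' y).const_mul (2 * π * (N : ℝ) ^ k)).cos).const_mul (r ^ k)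
  refine this.congr_deriv ?_
  rw [mul_pow]; ring

lemma sin_lip (x y : ℝ) : |-(2 * π) * sin (2 * π * x) - -(2 * π) * sin (2 * π * y)| ≤ 40 * |x - y| := by
  have h : |sin (2 * π * x) - sin (2 * π * y)| ≤ |2 * π * x - 2 * π * y| := by
    have := Real.lipschitzWith_sin.dist_le_mul (2 * π * x) (2 * π * y)
    simpa [Real.dist_eq] using this
  rw [← mul_sub, abs_mul, abs_neg, abs_of_pos (by positivity : (0:ℝ) < 2 * π)]
  rw [← mul_sub, abs_mul, abs_of_pos (by positivity : (0:ℝ) < 2 * π)] at h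
  calc _ ≤ 2 * π * (2 * π * |x - y|) := by gcongr
    _ = (4 * π ^ 2) * |x - y| := by ring
    _ ≤ _ := by
      gcongr
      nlinarith [Real.pi_lt_d2, Real.pi_pos]

lemma GG_holder {s α : ℝ} {N : ℕ} (hN : 2 ≤ N) (h0 : 0 ≤ s) (h1 : s < 1) (ha : 0 < α)
    (hsa : s * (N : ℝ) ^ α = 1) (hQ : 2 ≤ s * N) :
    ∃ C : ℝ, 0 < C ∧ ∀ x y : ℝ, |GG s N x - GG s N y| ≤ C * |x - y| ^ α := by
  set L := 2 * π * (1 - s)⁻¹ with hL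
  have hLp : 0 < L := by have : 0 < 1 - s := by linarith
                         positivity
  have hNp : (0:ℝ) < N := by positivity
  have hNa : (0:ℝ) < (N:ℝ) ^ α := by positivity
  have hNa1 : (1:ℝ) ≤ (N:ℝ) ^ α := Real.one_le_rpow (by exact_mod_cast (by omega : 1 ≤ N)) ha.le
  have hsup : ∀ x y, |GG s N x - GG s N y| ≤ 2 * L := fun x y => by
    have := abs_sub (GG s N x) (GG s N y)
    linarith [GG_bound h0 h1 N x, GG_bound h0 h1 N y]
  set C := (2 * L + 40) * (N : ℝ) ^ α with hC
  have base : ∀ x y, 1 / (N:ℝ) ≤ |x - y| → |x - y| ≤ 1 →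
      |GG s N x - GG s N y| ≤ C * |x - y| ^ α - 40 * |x - y| := by
    intro x y h h'
    have h2 : (1 / (N:ℝ)) ^ α ≤ |x - y| ^ α := Real.rpow_le_rpow (by positivity) h ha.le
    rw [Real.div_rpow (by norm_num) hNp.le, Real.one_rpow] at h2
    have h3 : C * (1 / (N:ℝ) ^ α) ≤ C * |x - y| ^ α :=
      mul_le_mul_of_nonneg_left h2 (by positivity)
    have h4 : C * (1 / (N:ℝ) ^ α) = 2 * L + 40 := by rw [hC]; field_simp
    linarith [hsup x y]
  have ind : ∀ m : ℕ, ∀ x y, (1 / (N:ℝ)) ^ (m + 1) ≤ |x - y| → |x - y| ≤ 1 →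
      |GG s N x - GG s N y| ≤ C * |x - y| ^ α - 40 * |x - y| := by
    intro m
    induction m with
    | zero => intro x y h h'; exact base x y (by simpa using h) h'
    | succ m ih =>
      intro x y h h'
      by_cases hd : 1 / (N:ℝ) ≤ |x - y|
      · exact base x y hd h'
      push Not at hd
      have hab : |(N:ℝ) * x - N * y| = N * |x - y| := by
        rw [← mul_sub, abs_mul, abs_of_pos hNp]
      have e1 := ih (N * x) (N * y) (by
        rw [hab]
        calc (1 / (N:ℝ)) ^ (m + 1) = N * (1 / (N:ℝ)) ^ (m + 1 + 1) := by
              rw [pow_succ _ (m+1)]; field_simp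
          _ ≤ _ := by gcongr) (by
        rw [hab]
        calc (N:ℝ) * |x - y| ≤ N * (1 / N) := by gcongr
          _ = 1 := by field_simp)
      rw [hab, Real.mul_rpow hNp.le (abs_nonneg _)] at e1
      rw [GG_eq h0 h1 N x, GG_eq h0 h1 N y]
      have e2 : -(2 * π) * sin (2 * π * x) + s * GG s N (N * x) -
          (-(2 * π) * sin (2 * π * y) + s * GG s N (N * y)) =
          (-(2 * π) * sin (2 * π * x) - -(2 * π) * sin (2 * π * y)) +
          s * (GG s N (N * x) - GG s N (N * y)) := by ring
      rw [e2]
      refine (abs_add_le _ _).trans ?_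
      rw [abs_mul, abs_of_nonneg h0]
      have e3 := mul_le_mul_of_nonneg_left e1 h0
      have e4 : s * (C * ((N:ℝ) ^ α * |x - y| ^ α) - 40 * (N * |x - y|)) =
        (s * (N:ℝ) ^ α) * (C * |x - y| ^ α) - 40 * ((s * N) * |x - y|) := by ring
      rw [e4, hsa] at e3
      have e5 := sin_lip x y
      have e6 := mul_le_mul_of_nonneg_right hQ (abs_nonneg (x - y))
      linarith
  refine ⟨C, by positivity, fun x y => ?_⟩
  rcases eq_or_ne x y with rfl | hxy
  · simp [Real.zero_rpow ha.ne']
  have hpos : 0 < |x - y| := abs_pos.2 (sub_ne_zero.2 hxy)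
  by_cases hd : |x - y| ≤ 1
  · obtain ⟨m, hm⟩ := exists_pow_lt_of_lt_one hpos (y := 1 / (N:ℝ)) (by
      rw [div_lt_one hNp]; exact_mod_cast (by omega : 1 < N))
    have := ind m x y (le_trans (pow_le_pow_of_le_one (by positivity) (by
      rw [div_le_one hNp]; exact_mod_cast (by omega : 1 ≤ N)) (Nat.le_succ m)) hm.le) hd
    linarith
  · push Not at hd
    have h5 := Real.one_le_rpow hd.le ha.le
    have h6 : 2 * L ≤ C := by rw [hC]; nlinarith
    nlinarith [hsup x y]

/-- twice the signed area of the triangle -/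
def tdet (f : ℝ → ℝ) (x y z : ℝ) : ℝ := (y - x) * (f z - f y) - (z - y) * (f y - f x)

lemma tdet_cos {x y z : ℝ} (h1 : x < y) (h2 : y < z) :
    |tdet (fun t => cos (2 * π * t)) x y z| ≤ 40 * ((y - x) * (z - y) * (z - x)) := by
  have hd : ∀ t, HasDerivAt (fun t => cos (2 * π * t)) (-(2 * π) * sin (2 * π * t)) t := by
    intro t
    have := ((hasDerivAt_id' t).const_mul (2 * π)).cos
    convert this using 1
    ring
  have hc : Continuous (fun t => cos (2 * π * t)) := by fun_prop
  obtain ⟨a, ha, ea⟩ := exists_hasDerivAt_eq_slope _ _ h1 hc.continuousOn (fun t _ => hd t)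
  obtain ⟨b, hb, eb⟩ := exists_hasDerivAt_eq_slope _ _ h2 hc.continuousOn (fun t _ => hd t)
  have p1 : 0 < y - x := by linarith
  have p2 : 0 < z - y := by linarith
  rw [eq_div_iff p1.ne'] at ea
  rw [eq_div_iff p2.ne'] at eb
  have : tdet (fun t => cos (2 * π * t)) x y z =
      (y - x) * (z - y) * (-(2 * π) * sin (2 * π * b) - -(2 * π) * sin (2 * π * a)) := by
    unfold tdet; rw [← ea, ← eb]; ring
  rw [this, abs_mul, abs_of_pos (by positivity : 0 < (y - x) * (z - y))]
  have h3 := sin_lip b a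
  have h4 : |b - a| ≤ z - x := by rw [abs_le]; constructor <;> linarith [ha.1, ha.2, hb.1, hb.2]
  calc _ ≤ (y - x) * (z - y) * (40 * (z - x)) := by gcongr; linarith
    _ = _ := by ring

lemma tdet_scale {r : ℝ} (h0 : 0 ≤ r) (h1 : r < 1) {N : ℕ} (hN : 2 ≤ N) (x y z : ℝ) :
    tdet (FF r N) x y z = tdet (fun t => cos (2 * π * t)) x y z +
      r / N * tdet (FF r N) (N * x) (N * y) (N * z) := by
  have : (N:ℝ) ≠ 0 := by positivity
  unfold tdet
  rw [FF_eq h0 h1 N x, FF_eq h0 h1 N y, FF_eq h0 h1 N z]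
  field_simp
  ring

lemma tdet_base {r : ℝ} (h0 : 0 ≤ r) {m : ℕ} (h1 : r < 1)  (hs : r * (2 * m : ℕ) < 1) :
    ∃ δ : ℝ, 0 < δ ∧ δ ≤ 1 / 8 ∧ ∀ u v w, 0 ≤ u → u ≤ δ → 1 / 2 - δ ≤ v → v ≤ 1 / 2 + δ →
      1 - δ ≤ w → w ≤ 1 →
      2 * ((v - u) * (w - v) * (w - u)) ≤ |tdet (FF r (2 * m)) u v w| := by
  have hc : Continuous (FF r (2 * m)) :=
    continuous_iff_continuousAt.2 fun x => (FF_hasDerivAt (2 * m) h0 h1 hs x).continuousAt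
  have hval : tdet (FF r (2 * m)) 0 (1/2) 1 = 2 := by
    have e1 : FF r (2 * m) 1 = FF r (2 * m) 0 := by simpa using FF_add_nat r (2 * m) 0 1
    have e2 := FF_eq h0 h1 (2 * m) 0
    have e3 := FF_eq h0 h1 (2 * m) (1/2)
    have e4 : FF r (2 * m) ((2 * m : ℕ) * (1/2)) = FF r (2 * m) 0 := by
      rw [← FF_add_nat r (2 * m) 0 m]; congr 1; push_cast; ring
    rw [e4, show 2 * π * (1/2) = π by ring, cos_pi] at e3
    simp only [mul_zero, cos_zero] at e2
    unfold tdet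
    rw [e1]
    linarith
  have hopen : IsOpen {q : ℝ × ℝ × ℝ | 2 * ((q.2.1 - q.1) * (q.2.2 - q.2.1) * (q.2.2 - q.1)) <
      |tdet (FF r (2 * m)) q.1 q.2.1 q.2.2|} := by
    apply isOpen_lt
    · fun_prop
    · unfold tdet; fun_prop
  obtain ⟨ε, he, hb⟩ := Metric.isOpen_iff.1 hopen (0, 1/2, 1) (by
    simp only [mem_ofPred_eq, hval]; norm_num)
  refine ⟨min (ε / 2) (1/8), by positivity, min_le_right _ _, ?_⟩
  intro u v w a1 a2 a3 a4 a5 a6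
  have hm := min_le_left (ε / 2) (1/8)
  have : (u, v, w) ∈ Metric.ball ((0:ℝ), (1/2:ℝ), (1:ℝ)) ε := by
    simp only [Metric.mem_ball, Prod.dist_eq, Real.dist_eq, max_lt_iff, abs_lt]
    refine ⟨⟨?_, ?_⟩, ⟨?_, ?_⟩, ?_, ?_⟩ <;> linarith
  exact (hb this).le

lemma tdet_lower {r δ : ℝ} (h0 : 0 ≤ r) {N : ℕ} (hN : 2 ≤ N) (h1 : r < 1) (hQ : 41 ≤ r * N ^ 2)
    (hδ : δ ≤ 1 / 8)
    (hb : ∀ u v w, 0 ≤ u → u ≤ δ → 1 / 2 - δ ≤ v → v ≤ 1 / 2 + δ →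
      1 - δ ≤ w → w ≤ 1 →
      2 * ((v - u) * (w - v) * (w - u)) ≤ |tdet (FF r N) u v w|) (i k : ℕ) :
    ∀ x y z : ℝ, (i:ℝ) ≤ N ^ k * x → N ^ k * x ≤ i + δ → i + (1 / 2 - δ) ≤ N ^ k * y →
      N ^ k * y ≤ i + (1 / 2 + δ) → i + (1 - δ) ≤ N ^ k * z → N ^ k * z ≤ i + 1 →
      ((r * N ^ 2) ^ k + 1) * ((y - x) * (z - y) * (z - x)) ≤ |tdet (FF r N) x y z| := by
  have hNp : (0:ℝ) < N := by positivity
  induction k with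
  | zero =>
    intro x y z a1 a2 a3 a4 a5 a6
    simp only [pow_zero, one_mul] at *
    have := hb (x - i) (y - i) (z - i) (by linarith) (by linarith) (by linarith) (by linarith)
      (by linarith) (by linarith)
    have e : tdet (FF r N) (x - i) (y - i) (z - i) = tdet (FF r N) x y z := by
      unfold tdet
      rw [← FF_add_nat r N (x - i) i, ← FF_add_nat r N (y - i) i, ← FF_add_nat r N (z - i) i]
      simp
    rw [e] at this
    refine le_trans (le_of_eq ?_) this
    ring
  | succ k ih =>
    intro x y z a1 a2 a3 a4 a5 a6
    have hp : (0:ℝ) < N ^ (k + 1) := by positivity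
    have hxy : x < y := lt_of_mul_lt_mul_left (by linarith : (N:ℝ) ^ (k+1) * x < N ^ (k+1) * y) hp.le
    have hyz : y < z := lt_of_mul_lt_mul_left (by linarith : (N:ℝ) ^ (k+1) * y < N ^ (k+1) * z) hp.le
    have e : ∀ t : ℝ, (N:ℝ) ^ (k + 1) * t = N ^ k * (N * t) := fun t => by ring
    rw [e] at a1 a2 a3 a4 a5 a6
    have h := ih _ _ _ a1 a2 a3 a4 a5 a6
    have hc := tdet_cos hxy hyz
    rw [tdet_scale h0 h1 hN]
    set T := tdet (FF r N) (N * x) (N * y) (N * z)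
    set W := (y - x) * (z - y) * (z - x) with hW
    have hWp : 0 < W := by
      have p1 : 0 < y - x := by linarith
      have p2 : 0 < z - y := by linarith
      have p3 : 0 < z - x := by linarith
      positivity
    have e2 : r / N * (((r * N ^ 2) ^ k + 1) * ((N * y - N * x) * (N * z - N * y) * (N * z - N * x)))
       = ((r * N ^ 2) ^ (k + 1) + r * N ^ 2) * W := by
      rw [hW]; field_simp; ring
    have e3 := mul_le_mul_of_nonneg_left h (by positivity : 0 ≤ r / N)
    rw [e2] at e3
    have e4 : |r / N * T| = r / N * |T| := by
      rw [abs_mul, abs_of_nonneg (by positivity : 0 ≤ r / (N:ℝ))]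
    have e5 := abs_sub_abs_le_abs_add (r / N * T) (tdet (fun t => cos (2 * π * t)) x y z)
    rw [add_comm (r / N * T)] at e5
    nlinarith

lemma triangle_area (a b c : EuclideanSpace ℝ (Fin 2)) :
    |(b 0 - a 0) * (c 1 - a 1) - (c 0 - a 0) * (b 1 - a 1)| / 4 ≤
      (μH[2] (convexHull ℝ {a, b, c})).toReal := by
  set T := convexHull ℝ {a, b, c} with hT
  have hfin : μH[2] T ≠ ⊤ := by
    have hcomp : IsCompact T := (Set.toFinite {a, b, c}).isCompact_convexHull ℝ
    have h : Module.finrank ℝ (EuclideanSpace ℝ (Fin 2)) = 2 := by simp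
    have hH : (μH[2] : Measure (EuclideanSpace ℝ (Fin 2))) =
      μH[(Module.finrank ℝ (EuclideanSpace ℝ (Fin 2)) : ℕ)] := by rw [h]; norm_num
    rw [hH]
    exact hcomp.measure_lt_top.ne
  set A : Matrix (Fin 2) (Fin 2) ℝ := !![b 0 - a 0, c 0 - a 0; b 1 - a 1, c 1 - a 1] with hA
  set S : Set (Fin 2 → ℝ) := Icc 0 (fun _ => 1 / 2)
  have hsub : (fun v => WithLp.ofLp a + v) '' (Matrix.toLin' A '' S) ⊆ WithLp.ofLp '' T := by
    rintro _ ⟨_, ⟨v, hv, rfl⟩, rfl⟩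
    have h0 : 0 ≤ v 0 := hv.1 0
    have h1 : 0 ≤ v 1 := hv.1 1
    have h0' : v 0 ≤ 1 / 2 := hv.2 0
    have h1' : v 1 ≤ 1 / 2 := hv.2 1
    refine ⟨(1 - v 0 - v 1) • a + v 0 • b + v 1 • c, ?_, ?_⟩
    · have hc := convex_convexHull ℝ ({a, b, c} : Set (EuclideanSpace ℝ (Fin 2)))
      have ha : a ∈ T := subset_convexHull ℝ _ (by simp)
      have hb : b ∈ T := subset_convexHull ℝ _ (by simp)
      have hcc : c ∈ T := subset_convexHull ℝ _ (by simp)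
      rw [hT, convexHull_insert (by simp), convexHull_pair, mem_convexJoin]
      by_cases hz : v 0 + v 1 = 0
      · have z0 : v 0 = 0 := by linarith
        have z1 : v 1 = 0 := by linarith
        refine ⟨a, rfl, b, left_mem_segment ℝ b c, ?_⟩
        simp [z0, z1, left_mem_segment]
      · have hp : 0 < v 0 + v 1 := lt_of_le_of_ne (by linarith) (Ne.symm hz)
        refine ⟨a, rfl, (v 0 / (v 0 + v 1)) • b + (v 1 / (v 0 + v 1)) • c,
          ⟨_, _, by positivity, by positivity, by field_simp, rfl⟩,
          ⟨1 - v 0 - v 1, v 0 + v 1, by linarith, by linarith, by ring, ?_⟩⟩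
        rw [smul_add, smul_smul, smul_smul, mul_div_cancel₀ _ hz, mul_div_cancel₀ _ hz, add_assoc]
    · ext i
      fin_cases i
      · simp [hA, Matrix.toLin'_apply, Matrix.mulVec, dotProduct, Fin.sum_univ_two]; ring
      · simp [hA, Matrix.toLin'_apply, Matrix.mulVec, dotProduct, Fin.sum_univ_two]; ring
  have hvol : volume ((fun v => WithLp.ofLp a + v) '' (Matrix.toLin' A '' S)) =
      ENNReal.ofReal (|(b 0 - a 0) * (c 1 - a 1) - (c 0 - a 0) * (b 1 - a 1)| / 4) := by
    have h1 := measure_preimage_add (volume : Measure (Fin 2 → ℝ)) (-WithLp.ofLp a) (Matrix.toLin' A '' S)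
    rw [Set.image_add_left, h1, Measure.addHaar_image_linearMap, LinearMap.det_toLin', hA,
      Matrix.det_fin_two_of, Real.volume_Icc_pi, Fin.prod_univ_two]
    simp only [Pi.zero_apply, sub_zero]
    rw [← ENNReal.ofReal_mul (by norm_num), ← ENNReal.ofReal_mul (abs_nonneg _)]
    congr 1; ring
  have hle : volume (WithLp.ofLp '' T) ≤ μH[2] T := by
    have hl := (PiLp.lipschitzWith_ofLp 2 (fun _ : Fin 2 => ℝ)).hausdorffMeasure_image_le
      (d := 2) (by norm_num) T
    rw [← hausdorffMeasure_pi_real]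
    simpa using hl
  have := (measure_mono hsub).trans hle
  rw [hvol] at this
  exact (ENNReal.ofReal_le_iff_le_toReal hfin).1 this

lemma graph_dist {F : ℝ → ℝ} {L : ℝ} (hL : 0 ≤ L) (hF : ∀ x y, |F x - F y| ≤ L * |x - y|) (x y : ℝ) :
    dist (graphPt F x) (graphPt F y) ≤ (1 + L) * |x - y| := by
  rw [EuclideanSpace.dist_eq, Fin.sum_univ_two]
  apply Real.sqrt_le_iff.2
  refine ⟨by positivity, ?_⟩
  have h0 : dist ((graphPt F x) 0) ((graphPt F y) 0) = |x - y| := by simp [graphPt, Real.dist_eq]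
  have h1 : dist ((graphPt F x) 1) ((graphPt F y) 1) = |F x - F y| := by simp [graphPt, Real.dist_eq]
  rw [h0, h1]
  have := hF x y
  have p1 := abs_nonneg (x - y)
  have p2 := abs_nonneg (F x - F y)
  have : |F x - F y| ^ 2 ≤ (L * |x - y|) ^ 2 := by gcongr
  nlinarith [mul_nonneg hL (sq_nonneg |x - y|)]

lemma curv_lower {F : ℝ → ℝ} {L q : ℝ} (hL : 0 ≤ L) (hF : ∀ x y, |F x - F y| ≤ L * |x - y|) 
    {x y z : ℝ} (hxy : x < y) (hyz : y < z)
    (h : q * ((y - x) * (z - y) * (z - x)) ≤ |tdet F x y z|) :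
    q / (1 + L) ^ 3 ≤ mengerCurv (graphPt F x) (graphPt F y) (graphPt F z) := by
  have hinj : ∀ s t, s < t → 0 < dist (graphPt F s) (graphPt F t) := by
    intro s t hst
    rw [dist_pos]
    intro he
    have : (graphPt F s) 0 = (graphPt F t) 0 := by rw [he]
    simp [graphPt] at this
    linarith
  have p1 := hinj x y hxy
  have p2 := hinj y z hyz
  have p3 := hinj x z (hxy.trans hyz)
  have d1 := graph_dist hL hF x y
  have d2 := graph_dist hL hF y z
  have d3 := graph_dist hL hF x z
  rw [abs_sub_comm, abs_of_pos (by linarith)] at d1 d2 d3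
  have ht := triangle_area (graphPt F x) (graphPt F y) (graphPt F z)
  have e : |((graphPt F y) 0 - (graphPt F x) 0) * ((graphPt F z) 1 - (graphPt F x) 1) -
    ((graphPt F z) 0 - (graphPt F x) 0) * ((graphPt F y) 1 - (graphPt F x) 1)| = |tdet F x y z| := by
    congr 1
    simp [graphPt, tdet]; ring
  rw [e] at ht
  have hxy' : 0 < y - x := by linarith
  have hyz' : 0 < z - y := by linarith
  have hxz' : 0 < z - x := by linarith
  unfold mengerCurv
  set m := (μH[2] (convexHull ℝ {graphPt F x, graphPt F y, graphPt F z})).toReal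
  have hprod : dist (graphPt F x) (graphPt F y) * dist (graphPt F y) (graphPt F z) *
     dist (graphPt F x) (graphPt F z) ≤ (1 + L) ^ 3 * ((y - x) * (z - y) * (z - x)) := by
    calc _ ≤ ((1 + L) * (y - x)) * ((1 + L) * (z - y)) * ((1 + L) * (z - x)) := by gcongr
      _ = _ := by ring
  have hm : 0 ≤ m := ENNReal.toReal_nonneg
  calc q / (1 + L) ^ 3 = (q * ((y - x) * (z - y) * (z - x))) / ((1 + L) ^ 3 * ((y - x) * (z - y) * (z - x))) := by
        field_simp
    _ ≤ (4 * m) / ((1 + L) ^ 3 * ((y - x) * (z - y) * (z - x))) := by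
        exact div_le_div_of_nonneg_right (by linarith) (by positivity)
    _ ≤ _ := by gcongr

lemma energy_top {N : ℕ} (hN : 2 ≤ N) {δ : ℝ} (hδ0 : 0 < δ) (hδ : δ ≤ 1 / 8) {c : ℝ≥0∞} (hc : c ≠ 0)
    (f : ℝ → ℝ → ℝ → ℝ≥0∞)
    (hf : ∀ i k : ℕ, ∀ x y z : ℝ, (i:ℝ) ≤ N ^ k * x → N ^ k * x ≤ i + δ → i + (1 / 2 - δ) ≤ N ^ k * y →
      N ^ k * y ≤ i + (1 / 2 + δ) → i + (1 - δ) ≤ N ^ k * z → N ^ k * z ≤ i + 1 →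
      c * (N:ℝ≥0∞) ^ (2 * k) ≤ f x y z) :
    (∫⁻ x in Icc (0:ℝ) 1, ∫⁻ y in Icc (0:ℝ) 1, ∫⁻ z in Icc (0:ℝ) 1, f x y z) = ⊤ := by
  have hNp : (0:ℝ) < N := by positivity
  let I := Σ k : ℕ, Fin (N ^ k)
  let J : I → ℝ → ℝ → Set ℝ := fun q a b => Icc ((q.2 + a) / (N:ℝ) ^ q.1) ((q.2 + b) / (N:ℝ) ^ q.1)
  have hJ : ∀ q a b t, t ∈ J q a b ↔ (q.2:ℝ) + a ≤ N ^ q.1 * t ∧ N ^ q.1 * t ≤ q.2 + b := by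
    intro q a b t
    have : (0:ℝ) < N ^ q.1 := by positivity
    simp only [J, mem_Icc, div_le_iff₀ this, le_div_iff₀ this, mul_comm t]
  have hJm : ∀ q a b, MeasurableSet (J q a b) := fun q a b => measurableSet_Icc
  have hJv : ∀ q a b, 0 ≤ a → b ≤ 1 → volume.restrict (Icc (0:ℝ) 1) (J q a b) =
      ENNReal.ofReal (b - a) / (N:ℝ≥0∞) ^ q.1 := by
    intro q a b ha hb
    have hp : (0:ℝ) < N ^ q.1 := by positivity
    rw [Measure.restrict_apply (hJm q a b), inter_eq_left.2, Real.volume_Icc, ← sub_div,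
      ENNReal.ofReal_div_of_pos hp, ENNReal.ofReal_pow hNp.le, ENNReal.ofReal_natCast]
    · congr 2; ring
    · apply Icc_subset_Icc
      · positivity
      · rw [div_le_one hp]
        have : (q.2:ℕ) + 1 ≤ N ^ q.1 := q.2.2
        have : ((q.2:ℕ):ℝ) + 1 ≤ N ^ q.1 := by exact_mod_cast this
        linarith
  let w : I → ℝ≥0∞ := fun q => c * (N:ℝ≥0∞) ^ (2 * q.1)
  let iA : I → ℝ → ℝ≥0∞ := fun q => (J q 0 δ).indicator 1
  let iB : I → ℝ → ℝ≥0∞ := fun q => (J q (1/2 - δ) (1/2 + δ)).indicator 1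
  let iC : I → ℝ → ℝ≥0∞ := fun q => (J q (1 - δ) 1).indicator 1
  have mA : ∀ q, Measurable (iA q) := fun q => measurable_one.indicator (hJm _ _ _)
  have mB : ∀ q, Measurable (iB q) := fun q => measurable_one.indicator (hJm _ _ _)
  have mC : ∀ q, Measurable (iC q) := fun q => measurable_one.indicator (hJm _ _ _)
  have hpt : ∀ x y z, ∑' q, w q * iA q x * iB q y * iC q z ≤ f x y z := by
    intro x y z
    by_cases hex : ∃ q, x ∈ J q 0 δ ∧ y ∈ J q (1/2 - δ) (1/2 + δ) ∧ z ∈ J q (1 - δ) 1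
    · obtain ⟨q, hx, hy, hz⟩ := hex
      rw [tsum_eq_single q]
      · simp only [iA, iB, iC, indicator_of_mem hx, indicator_of_mem hy, indicator_of_mem hz,
          Pi.one_apply, mul_one, w]
        rw [hJ] at hx hy hz
        exact hf q.2 q.1 x y z (by linarith [hx.1]) hx.2 hy.1 hy.2 hz.1 hz.2
      · intro q' hne
        by_contra h0
        apply hne
        have hx' : x ∈ J q' 0 δ := by
          by_contra h; apply h0; simp [iA, indicator_of_notMem h]
        have hz' : z ∈ J q' (1 - δ) 1 := by
          by_contra h; apply h0; simp [iC, indicator_of_notMem h]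
        rw [hJ] at hx hz hx' hz'
        have key : ∀ k l : ℕ, k < l → ∀ s : ℝ, 3 / 4 ≤ N ^ k * s → N ^ l * s ≤ 1 → False := by
          intro k l hkl s h1 h2
          obtain ⟨d, rfl⟩ := Nat.exists_eq_add_of_lt hkl
          have hs : 2 ≤ (N:ℝ) ^ (d + 1) := by
            calc (2:ℝ) ≤ N := by exact_mod_cast hN
              _ ≤ (N:ℝ) ^ (d + 1) := le_self_pow₀ (by exact_mod_cast (by omega : 1 ≤ N)) (by omega)
          have : (N:ℝ) ^ (k + d + 1) * s = N ^ (d + 1) * (N ^ k * s) := by ring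
          nlinarith
        have hk : q'.1 = q.1 := by
          rcases lt_trichotomy q'.1 q.1 with h | h | h
          · exact (key _ _ h (z - x) (by linarith [mul_sub ((N:ℝ) ^ q'.1) z x])
              (by linarith [mul_sub ((N:ℝ) ^ q.1) z x])).elim
          · exact h
          · exact (key _ _ h (z - x) (by linarith [mul_sub ((N:ℝ) ^ q.1) z x])
              (by linarith [mul_sub ((N:ℝ) ^ q'.1) z x])).elim
        obtain ⟨k, i⟩ := q
        obtain ⟨k', i'⟩ := q'
        dsimp only at hk
        subst hk
        dsimp only at hx hx'
        congr 1
        apply Fin.ext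
        have l1 : ((i':ℕ):ℝ) < ((i:ℕ):ℝ) + 1 := by linarith
        have l2 : ((i:ℕ):ℝ) < ((i':ℕ):ℝ) + 1 := by linarith
        have l1' : (i':ℕ) < (i:ℕ) + 1 := by exact_mod_cast l1
        have l2' : (i:ℕ) < (i':ℕ) + 1 := by exact_mod_cast l2
        omega
    · have : ∀ q, w q * iA q x * iB q y * iC q z = 0 := by
        intro q
        by_contra h0
        apply hex
        refine ⟨q, ?_, ?_, ?_⟩ <;> by_contra h <;> apply h0 <;>
          simp only [iA, iB, iC, indicator_of_notMem h, mul_zero, zero_mul]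
      simp [this]
  have hint : (∫⁻ x in Icc (0:ℝ) 1, ∫⁻ y in Icc (0:ℝ) 1, ∫⁻ z in Icc (0:ℝ) 1,
      ∑' q, w q * iA q x * iB q y * iC q z) = ⊤ := by
    have s1 : ∀ x y, ∫⁻ z in Icc (0:ℝ) 1, ∑' q, w q * iA q x * iB q y * iC q z =
        ∑' q, w q * iA q x * iB q y * (ENNReal.ofReal (1 - (1 - δ)) / (N:ℝ≥0∞) ^ q.1) := by
      intro x y
      rw [lintegral_tsum (fun q => ((mC q).const_mul _).aemeasurable)]
      congr 1; ext q
      rw [lintegral_const_mul _ (mC q), lintegral_indicator_one (hJm _ _ _),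
        hJv _ _ _ (by linarith) le_rfl]
    have s2 : ∀ x, ∫⁻ y in Icc (0:ℝ) 1, ∑' q, w q * iA q x * iB q y *
          (ENNReal.ofReal (1 - (1 - δ)) / (N:ℝ≥0∞) ^ q.1) =
        ∑' q, w q * iA q x * (ENNReal.ofReal ((1/2 + δ) - (1/2 - δ)) / (N:ℝ≥0∞) ^ q.1) *
          (ENNReal.ofReal (1 - (1 - δ)) / (N:ℝ≥0∞) ^ q.1) := by
      intro x
      rw [lintegral_tsum (fun q => (((mB q).const_mul _).mul_const _).aemeasurable)]
      congr 1; ext q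
      rw [lintegral_mul_const _ ((mB q).const_mul _), lintegral_const_mul _ (mB q),
        lintegral_indicator_one (hJm _ _ _), hJv _ _ _ (by linarith) (by linarith)]
    simp_rw [s1, s2]
    rw [lintegral_tsum (fun q => ((((mA q).const_mul _).mul_const _).mul_const _).aemeasurable)]
    have s3 : ∀ q : I, ∫⁻ x in Icc (0:ℝ) 1, w q * iA q x *
        (ENNReal.ofReal ((1/2 + δ) - (1/2 - δ)) / (N:ℝ≥0∞) ^ q.1) *
          (ENNReal.ofReal (1 - (1 - δ)) / (N:ℝ≥0∞) ^ q.1) =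
        (c * ENNReal.ofReal δ * ENNReal.ofReal (2 * δ) * ENNReal.ofReal δ) * ((N:ℝ≥0∞) ^ q.1)⁻¹ := by
      intro q
      rw [lintegral_mul_const _ (((mA q).const_mul _).mul_const _),
        lintegral_mul_const _ ((mA q).const_mul _), lintegral_const_mul _ (mA q),
        lintegral_indicator_one (hJm _ _ _), hJv _ _ _ le_rfl (by linarith)]
      have n0 : (N:ℝ≥0∞) ^ q.1 ≠ 0 := pow_ne_zero _ (by simp; omega)
      have nt : (N:ℝ≥0∞) ^ q.1 ≠ ⊤ := ENNReal.pow_ne_top (ENNReal.natCast_ne_top N)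
      simp only [w]
      rw [show (1:ℝ) - (1 - δ) = δ by ring, show ((1:ℝ)/2 + δ) - (1/2 - δ) = 2 * δ by ring, sub_zero,
        mul_comm 2 q.1, pow_mul]
      set M := (N:ℝ≥0∞) ^ q.1
      simp only [div_eq_mul_inv]
      calc _ = (c * ENNReal.ofReal δ * ENNReal.ofReal (2 * δ) * ENNReal.ofReal δ) * M⁻¹ *
            (M * M⁻¹) * (M * M⁻¹) := by ring
        _ = _ := by rw [ENNReal.mul_inv_cancel n0 nt]; simp
    simp_rw [s3]
    rw [ENNReal.tsum_sigma (fun (k : ℕ) (_ : Fin (N ^ k)) =>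
      (c * ENNReal.ofReal δ * ENNReal.ofReal (2 * δ) * ENNReal.ofReal δ) * ((N:ℝ≥0∞) ^ k)⁻¹)]
    have s4 : ∀ k : ℕ, ∑' _ : Fin (N ^ k),
      (c * ENNReal.ofReal δ * ENNReal.ofReal (2 * δ) * ENNReal.ofReal δ) * ((N:ℝ≥0∞) ^ k)⁻¹ =
      c * ENNReal.ofReal δ * ENNReal.ofReal (2 * δ) * ENNReal.ofReal δ := by
      intro k
      have n0 : (N:ℝ≥0∞) ^ k ≠ 0 := pow_ne_zero _ (by simp; omega)
      have nt : (N:ℝ≥0∞) ^ k ≠ ⊤ := ENNReal.pow_ne_top (ENNReal.natCast_ne_top N)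
      rw [tsum_fintype, Finset.sum_const, Finset.card_univ, Fintype.card_fin, nsmul_eq_mul,
        mul_left_comm]
      push_cast
      rw [ENNReal.mul_inv_cancel n0 nt, mul_one]
    simp_rw [s4]
    apply ENNReal.tsum_const_eq_top_of_ne_zero
    simp [hc, hδ0]
  rw [eq_top_iff, ← hint]
  exact lintegral_mono fun x => lintegral_mono fun y => lintegral_mono fun z => hpt x y z

/-- For `p > 2` and `α = 1 - 2/p` there is `F ∈ C^{1,α}(ℝ)` whose
graph has infinite Menger curvature energy
`∭_{[0,1]³} R^{-p}((x,F x),(y,F y),(z,F z)) dx dy dz = ∞`. -/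
theorem exists_C1alpha_graph_infinite_energy (p : ℝ) (hp : 2 < p) :
    ∃ F F' : ℝ → ℝ,
      (∀ x : ℝ, HasDerivAt F (F' x) x) ∧
      (∃ C : ℝ, 0 < C ∧ ∀ x y : ℝ, |F' x - F' y| ≤ C * |x - y| ^ (1 - 2 / p)) ∧
      (∫⁻ x in Set.Icc (0 : ℝ) 1, ∫⁻ y in Set.Icc (0 : ℝ) 1, ∫⁻ z in Set.Icc (0 : ℝ) 1,
          ENNReal.ofReal (mengerCurv (graphPt F x) (graphPt F y) (graphPt F z) ^ p)) = ⊤ := by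
  have hp0 : 0 < p := by linarith
  have hb1 : 2 / p < 1 := by rw [div_lt_one hp0]; exact hp
  have hb0 : 0 < 2 / p := by positivity
  obtain ⟨m, hm1, hm2⟩ : ∃ m : ℕ, 1 ≤ m ∧ (41:ℝ) ≤ ((2 * m : ℕ) : ℝ) ^ (2 / p) := by
    have ht := (tendsto_rpow_atTop hb0).comp (tendsto_natCast_atTop_atTop (R := ℝ))
    have h := ((ht.eventually_ge_atTop 41).and (Filter.eventually_ge_atTop 1)).exists
    obtain ⟨n, hn, hn1⟩ := h
    refine ⟨n, hn1, hn.trans ?_⟩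
    apply Real.rpow_le_rpow (by positivity) _ hb0.le
    push_cast; linarith [(Nat.cast_nonneg n : (0:ℝ) ≤ n)]
  obtain ⟨N, hNm⟩ : ∃ N : ℕ, N = 2 * m := ⟨_, rfl⟩
  have hN : 2 ≤ N := by omega
  have hNp : (0:ℝ) < N := by positivity
  have hN1 : (1:ℝ) < N := by exact_mod_cast (by omega : 1 < N)
  rw [← hNm] at hm2
  obtain ⟨Q, hQ⟩ : ∃ Q : ℝ, Q = (N:ℝ) ^ (2 / p) := ⟨_, rfl⟩
  rw [← hQ] at hm2
  have hQN : Q < N := by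
    rw [hQ]
    calc (N:ℝ) ^ (2 / p) < (N:ℝ) ^ (1:ℝ) := Real.rpow_lt_rpow_of_exponent_lt hN1 hb1
      _ = N := Real.rpow_one _
  obtain ⟨r, hr⟩ : ∃ r : ℝ, r = Q / N ^ 2 := ⟨_, rfl⟩
  have hrQ : r * N ^ 2 = Q := by rw [hr]; field_simp
  have hrN : r * N = Q / N := by rw [hr]; field_simp
  have hr0 : 0 ≤ r := by rw [hr]; positivity
  have hs : r * N < 1 := by rw [hrN, div_lt_one hNp]; exact hQN
  have hr1 : r < 1 := by nlinarith
  have hs0 : 0 ≤ r * N := by positivity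
  obtain ⟨L, hLd⟩ : ∃ L : ℝ, L = 2 * π * (1 - r * N)⁻¹ := ⟨_, rfl⟩
  have hL : 0 ≤ L := by
    have : 0 < 1 - r * N := by linarith
    rw [hLd]; positivity
  have hder := FF_hasDerivAt N hr0 hr1 hs
  have hlip : ∀ x y, |FF r N x - FF r N y| ≤ L * |x - y| := by
    intro x y
    exact Convex.norm_image_sub_le_of_norm_hasDerivWithin_le (s := univ) (f := FF r N)
      (fun t _ => (hder t).hasDerivWithinAt)
      (fun t _ => by rw [hLd]; exact GG_bound hs0 hs N t) convex_univ (mem_univ y) (mem_univ x)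
  obtain ⟨δ, hδ0, hδ, hbase⟩ : ∃ δ : ℝ, 0 < δ ∧ δ ≤ 1 / 8 ∧ ∀ u v w, 0 ≤ u → u ≤ δ →
      1 / 2 - δ ≤ v → v ≤ 1 / 2 + δ → 1 - δ ≤ w → w ≤ 1 →
      2 * ((v - u) * (w - v) * (w - u)) ≤ |tdet (FF r N) u v w| := by
    subst hNm
    exact tdet_base hr0 hr1 hs
  refine ⟨FF r N, GG (r * N) N, hder, GG_holder hN hs0 hs (by linarith) ?_ ?_, ?_⟩
  · rw [hrN, hQ, div_mul_eq_mul_div, ← Real.rpow_add hNp]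
    rw [show 2 / p + (1 - 2 / p) = 1 by ring, Real.rpow_one, div_self hNp.ne']
  · have : r * N * N = Q := by rw [← hrQ]; ring
    linarith
  · refine energy_top hN hδ0 hδ (c := ENNReal.ofReal ((1 / (1 + L) ^ 3) ^ p)) ?_ _ ?_
    · have : 0 < (1 / (1 + L) ^ 3) ^ p := by positivity
      simpa using this
    intro i k x y z a1 a2 a3 a4 a5 a6
    have hlow := tdet_lower hr0 hN hr1 (by rw [hrQ]; exact hm2) hδ hbase i k x y z a1 a2 a3 a4 a5 a6
    have hk : (0:ℝ) < N ^ k := by positivity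
    have hxy : x < y := lt_of_mul_lt_mul_left (by linarith : (N:ℝ) ^ k * x < N ^ k * y) hk.le
    have hyz : y < z := lt_of_mul_lt_mul_left (by linarith : (N:ℝ) ^ k * y < N ^ k * z) hk.le
    have hcur := curv_lower hL hlip hxy hyz hlow
    rw [hrQ] at hcur
    have hQp : 0 < Q := by linarith
    have h1 : Q ^ k * (1 / (1 + L) ^ 3) ≤
        mengerCurv (graphPt (FF r N) x) (graphPt (FF r N) y) (graphPt (FF r N) z) := by
      refine le_trans ?_ hcur
      rw [mul_one_div]
      gcongr
      linarith
    have h2 := Real.rpow_le_rpow (by positivity) h1 hp0.le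
    refine le_trans (le_of_eq ?_) (ENNReal.ofReal_le_ofReal h2)
    rw [Real.mul_rpow (by positivity) (by positivity), mul_comm (ENNReal.ofReal _),
      ENNReal.ofReal_mul (by positivity)]
    congr 1
    have : (Q ^ k) ^ p = (N:ℝ) ^ (2 * k) := by
      rw [← Real.rpow_natCast Q k, hQ, ← Real.rpow_mul hNp.le, ← Real.rpow_mul hNp.le,
        ← Real.rpow_natCast (N:ℝ) (2 * k)]
      congr 1
      push_cast; field_simp
    rw [this, ENNReal.ofReal_pow hNp.le, ENNReal.ofReal_natCast]
end

section
/- Let p > m(m+1) and α = 1 - m(m+1)/p. There exists an m-dimensional manifold Σ ⊆ ℝ^{m+1} of class C^{1,α} (namely Σ = G([0,1]^m) where G(x¹,...,xᵐ) = (x¹,...,xᵐ, F(x¹)) for a suitable C^{1,α} function F : ℝ → ℝ) such that the integral curvature energy E_p(Σ) = ∫_{Σ^{m+2}} K^p dH^m···dH^m is infinite. -/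
open MeasureTheory Set Real ENNReal

/-- The graph map `G(x¹,…,xᵐ) = (x¹,…,xᵐ, F(x¹)) : ℝᵐ → ℝ^{m+1}`. -/
noncomputable def graphMap (m : ℕ) (hm : 0 < m) (F : ℝ → ℝ) (x : Fin m → ℝ) :
    EuclideanSpace ℝ (Fin (m + 1)) :=
  (EuclideanSpace.equiv (Fin (m + 1)) ℝ).symm (Fin.snoc x (F (x ⟨0, hm⟩)))

set_option linter.unusedVariables false

lemma aux_cos_taylor (u v : ℝ) : |cos (u + v) - cos u + v * sin u| ≤ 2 * v ^ 2 := by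
  have h1 : cos (u + v) - cos u + v * sin u = cos u * (cos v - 1) + sin u * (v - sin v) := by
    rw [cos_add]; ring
  have h2 : |cos v - 1| ≤ v ^ 2 := by
    rw [abs_le]
    constructor
    · nlinarith [Real.one_sub_sq_div_two_le_cos (x := v), sq_nonneg v]
    · nlinarith [Real.cos_le_one v, sq_nonneg v]
  have h3 : ∀ v : ℝ, 0 ≤ v → |v - sin v| ≤ v ^ 2 := by
    intro v hv
    rw [abs_of_nonneg (by linarith [Real.sin_le hv])]
    rcases eq_or_lt_of_le hv with rfl | hv0
    · simp
    by_cases h : v ≤ 1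
    · have := Real.sin_gt_sub_cube hv0
      nlinarith [mul_nonneg (sq_nonneg v) (sub_nonneg.2 h), sq_nonneg v]
    · push Not at h
      by_cases h2 : v ≤ 2
      · have : 0 ≤ sin v := Real.sin_nonneg_of_nonneg_of_le_pi hv (by linarith [Real.pi_gt_three])
        nlinarith
      · nlinarith [Real.neg_one_le_sin v]
  have h4 : |v - sin v| ≤ v ^ 2 := by
    rcases le_total 0 v with h | h
    · exact h3 v h
    · have := h3 (-v) (by linarith)
      rw [Real.sin_neg, neg_sq] at this
      rwa [show -v - -sin v = -(v - sin v) by ring, abs_neg] at this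
  rw [h1]
  calc _ ≤ |cos u * (cos v - 1)| + |sin u * (v - sin v)| := abs_add_le _ _
    _ = |cos u| * |cos v - 1| + |sin u| * |v - sin v| := by rw [abs_mul, abs_mul]
    _ ≤ 1 * v ^ 2 + 1 * v ^ 2 := by
        gcongr
        · exact Real.abs_cos_le_one u
        · exact Real.abs_sin_le_one u
    _ = _ := by ring

lemma aux_sin_sub (x y : ℝ) : |sin x - sin y| ≤ |x - y| := by
  have := Real.abs_sin_sub_sin_le x y
  exact this

noncomputable def vW (N : ℕ) (w : ℝ) (x : ℝ) : ℝ := ∑' k : ℕ, w ^ k * cos (2 * π * (N ^ k * x))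
noncomputable def dvW (N : ℕ) (w : ℝ) (x : ℝ) : ℝ :=
  ∑' k : ℕ, -(2 * π) * ((w * N) ^ k * sin (2 * π * (N ^ k * x)))


lemma vW_w_lt (N : ℕ) (w : ℝ) (hw0 : 0 < w) (hN : 1 ≤ N) (hwN : w * N < 1) : w < 1 := by
  have : (1:ℝ) ≤ N := by exact_mod_cast hN
  nlinarith

lemma vW_summable (N : ℕ) (w : ℝ) (hw0 : 0 < w) (hN : 1 ≤ N) (hwN : w * N < 1) (x : ℝ) : Summable fun k : ℕ => w ^ k * cos (2 * π * (N ^ k * x)) := by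
  refine Summable.of_norm_bounded (summable_geometric_of_lt_one hw0.le (vW_w_lt N w hw0 hN hwN)) ?_
  intro k
  rw [norm_mul, norm_pow, Real.norm_of_nonneg hw0.le]
  exact mul_le_of_le_one_right (by positivity) (Real.abs_cos_le_one _)

lemma dvW_bound (N : ℕ) (w : ℝ) (hw0 : 0 < w) (hN : 1 ≤ N) (hwN : w * N < 1) (x : ℝ) (k : ℕ) :
    ‖-(2 * π) * ((w * N) ^ k * sin (2 * π * (N ^ k * x)))‖ ≤ 2 * π * (w * N) ^ k := by
  have hpos : 0 ≤ w * N := by positivity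
  rw [norm_mul, norm_mul, norm_pow, Real.norm_of_nonneg hpos, norm_neg,
    Real.norm_of_nonneg (by positivity)]
  gcongr
  exact mul_le_of_le_one_right (by positivity) (Real.abs_sin_le_one _)

lemma dvW_geo (N : ℕ) (w : ℝ) (hw0 : 0 < w) (hN : 1 ≤ N) (hwN : w * N < 1) : Summable fun k : ℕ => 2 * π * (w * N) ^ k :=
  (summable_geometric_of_lt_one (by positivity) hwN).mul_left _

lemma dvW_summable (N : ℕ) (w : ℝ) (hw0 : 0 < w) (hN : 1 ≤ N) (hwN : w * N < 1) (x : ℝ) :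
    Summable fun k : ℕ => -(2 * π) * ((w * N) ^ k * sin (2 * π * (N ^ k * x))) :=
  Summable.of_norm_bounded (dvW_geo N w hw0 hN hwN) (dvW_bound N w hw0 hN hwN x)

lemma vW_hasDerivAt (N : ℕ) (w : ℝ) (hw0 : 0 < w) (hN : 1 ≤ N) (hwN : w * N < 1) (x : ℝ) : HasDerivAt (vW N w) (dvW N w x) x := by
  unfold dvW
  refine hasDerivAt_tsum (g := fun k y => w ^ k * cos (2 * π * (N ^ k * y)))
    (y₀ := 0) (dvW_geo N w hw0 hN hwN) ?_ (fun n y => dvW_bound N w hw0 hN hwN y n)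
    (vW_summable N w hw0 hN hwN 0) x
  intro k y
  have h1 : HasDerivAt (fun y : ℝ => 2 * π * (N ^ k * y)) (2 * π * (N ^ k * 1)) y :=
    ((hasDerivAt_id y).const_mul _).const_mul _
  have := (h1.cos).const_mul (w ^ k)
  have e : -(2 * π) * ((w * N) ^ k * sin (2 * π * (N ^ k * y))) =
      w ^ k * (-sin (2 * π * (N ^ k * y)) * (2 * π * (N ^ k * 1))) := by
    rw [mul_pow]; ring
  rw [e]; exact this

lemma vW_abs_le (N : ℕ) (w : ℝ) (hw0 : 0 < w) (hN : 1 ≤ N) (hwN : w * N < 1) (x : ℝ) : |vW N w x| ≤ 1 / (1 - w) := by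
  have hw1 := vW_w_lt N w hw0 hN hwN
  have := tsum_of_norm_bounded (hasSum_geometric_of_lt_one hw0.le hw1)
    (f := fun k : ℕ => w ^ k * cos (2 * π * (N ^ k * x))) (by
      intro k
      rw [norm_mul, norm_pow, Real.norm_of_nonneg hw0.le]
      exact mul_le_of_le_one_right (by positivity) (Real.abs_cos_le_one _))
  rw [one_div]; exact this

lemma dvW_abs_le (N : ℕ) (w : ℝ) (hw0 : 0 < w) (hN : 1 ≤ N) (hwN : w * N < 1) (x : ℝ) : |dvW N w x| ≤ 2 * π * (1 - w * N)⁻¹ :=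
  tsum_of_norm_bounded ((hasSum_geometric_of_lt_one (by positivity) hwN).mul_left _)
    (dvW_bound N w hw0 hN hwN x)

lemma vW_self (N : ℕ) (w : ℝ) (hw0 : 0 < w) (hN : 1 ≤ N) (hwN : w * N < 1) (x : ℝ) : vW N w x = cos (2 * π * x) + w * vW N w (N * x) := by
  unfold vW
  rw [(vW_summable N w hw0 hN hwN x).tsum_eq_zero_add, ← tsum_mul_left]
  congr 1
  · simp
  · congr 1; ext k; rw [pow_succ, pow_succ]; ring_nf

lemma dvW_self (N : ℕ) (w : ℝ) (hw0 : 0 < w) (hN : 1 ≤ N) (hwN : w * N < 1) (x : ℝ) :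
    dvW N w x = -(2 * π) * sin (2 * π * x) + (w * N) * dvW N w (N * x) := by
  unfold dvW
  rw [(dvW_summable N w hw0 hN hwN x).tsum_eq_zero_add, ← tsum_mul_left]
  congr 1
  · simp
  · congr 1; ext k; rw [pow_succ, pow_succ]; ring_nf

lemma vW_periodic (N : ℕ) (w : ℝ) (hw0 : 0 < w) (hN : 1 ≤ N) (hwN : w * N < 1) (x : ℝ) (z : ℕ) : vW N w (z + x) = vW N w x := by
  unfold vW
  congr 1; ext k
  have : 2 * π * ((N:ℝ) ^ k * (z + x)) = 2 * π * (N ^ k * x) + ((N ^ k * z : ℕ) : ℝ) * (2 * π) := by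
    push_cast; ring
  rw [this, Real.cos_add_nat_mul_two_pi]

lemma vW_approx (N : ℕ) (w : ℝ) (hw0 : 0 < w) (hN : 1 ≤ N) (hwN : w * N < 1) (hlam : 1 < w * N ^ 2) (k z : ℕ) : ∃ a b : ℝ, ∀ t ∈ Icc (0:ℝ) 1,
    |(w ^ k)⁻¹ * vW N w ((z + t) / N ^ k) - cos (2 * π * t) - (a + b * t)|
      ≤ w / (1 - w) + 8 * π ^ 2 * ((1 - ((w * N ^ 2) ^ k)⁻¹) / (w * N ^ 2 - 1)) := by
  have hN0 : (0:ℝ) < N := by exact_mod_cast hN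
  induction k with
  | zero =>
    refine ⟨0, 0, fun t _ => ?_⟩
    simp only [pow_zero, inv_one, one_mul, div_one, zero_mul, add_zero, sub_zero, sub_self, zero_div,
      mul_zero]
    rw [vW_periodic N w hw0 hN hwN, vW_self N w hw0 hN hwN, add_sub_cancel_left, abs_mul,
      abs_of_pos hw0]
    have := vW_abs_le N w hw0 hN hwN (N * t)
    calc _ ≤ w * (1 / (1 - w)) := by gcongr
      _ = _ := by ring
  | succ k ih =>
    obtain ⟨a, b, h⟩ := ih
    set n : ℝ := (N:ℝ) ^ (k + 1) with hn
    have hn0 : 0 < n := by positivity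
    set u := 2 * π * (z / n) with hu
    refine ⟨a + (w ^ (k+1))⁻¹ * cos u, b - (w ^ (k+1))⁻¹ * (2 * π / n) * sin u, fun t ht => ?_⟩
    have h1 := h t ht
    have h2 := aux_cos_taylor u (2 * π * (t / n))
    have e1 : vW N w ((z + t) / n) = cos (u + 2 * π * (t / n)) + w * vW N w ((z + t) / N ^ k) := by
      rw [vW_self N w hw0 hN hwN]
      congr 2
      · rw [hu]; ring
      · congr 1; rw [hn, pow_succ]; field_simp
    have e2 : (w ^ (k+1))⁻¹ * vW N w ((z + t) / n) - cos (2 * π * t) -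
        (a + (w ^ (k+1))⁻¹ * cos u + (b - (w ^ (k+1))⁻¹ * (2 * π / n) * sin u) * t)
        = ((w ^ k)⁻¹ * vW N w ((z + t) / N ^ k) - cos (2 * π * t) - (a + b * t))
        + (w ^ (k+1))⁻¹ * (cos (u + 2 * π * (t / n)) - cos u + 2 * π * (t / n) * sin u) := by
      rw [e1]
      have : (w ^ (k+1))⁻¹ * w = (w ^ k)⁻¹ := by rw [pow_succ]; field_simp
      rw [← this]; ring
    rw [e2]
    have h3 : |(w ^ (k+1))⁻¹ * (cos (u + 2 * π * (t / n)) - cos u + 2 * π * (t / n) * sin u)|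
        ≤ 8 * π ^ 2 * ((w * N ^ 2) ^ (k+1))⁻¹ := by
      rw [abs_mul, abs_of_pos (by positivity : 0 < (w ^ (k+1))⁻¹)]
      calc _ ≤ (w ^ (k+1))⁻¹ * (2 * (2 * π * (t / n)) ^ 2) := by gcongr
        _ = 8 * π ^ 2 * ((w ^ (k+1))⁻¹ * (n ^ 2)⁻¹) * t ^ 2 := by field_simp; ring
        _ ≤ 8 * π ^ 2 * ((w ^ (k+1))⁻¹ * (n ^ 2)⁻¹) * 1 := by
            gcongr; exact pow_le_one₀ ht.1 ht.2
        _ = _ := by rw [mul_one, hn, mul_pow, mul_inv, ← pow_mul, ← pow_mul]; ring_nf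
    refine (abs_add_le _ _).trans ((add_le_add h1 h3).trans (le_of_eq ?_))
    have hl : w * (N:ℝ) ^ 2 - 1 ≠ 0 := by linarith
    set l := w * (N:ℝ) ^ 2
    have hl0 : l ≠ 0 := by linarith
    rw [pow_succ]
    field_simp
    ring

lemma vW_holder (N : ℕ) (w : ℝ) (hw0 : 0 < w) (hN : 1 ≤ N) (hwN : w * N < 1) (α : ℝ) (hα : 0 < α) (hθ : w * N * (N:ℝ) ^ α = 1) (hlam : 1 < w * N ^ 2) (hN2 : 2 ≤ N) :
    ∃ C : ℝ, 0 < C ∧ ∀ x y : ℝ, |dvW N w x - dvW N w y| ≤ C * |x - y| ^ α := by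
  have hN0 : (0:ℝ) < N := by exact_mod_cast hN
  have hN1 : (1:ℝ) ≤ N := by exact_mod_cast hN
  set l := w * (N:ℝ) ^ 2 with hl
  set B := 4 * π ^ 2 / (l - 1) with hB
  have hl1 : 0 < l - 1 := by linarith
  have hB0 : 0 < B := by positivity
  have hBe : 4 * π ^ 2 - B * l = - B := by rw [hB]; field_simp; ring
  set M := 2 * (2 * π * (1 - w * N)⁻¹) with hM
  have hM0 : 0 < M := by
    have : 0 < 1 - w * N := by linarith
    positivity
  have hMb : ∀ x y, |dvW N w x - dvW N w y| ≤ M := by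
    intro x y
    have h1 := dvW_abs_le N w hw0 hN hwN x
    have h2 := dvW_abs_le N w hw0 hN hwN y
    have := abs_sub (dvW N w x) (dvW N w y)
    linarith
  set C := M + B * N with hC
  have hC0 : 0 < C := by positivity
  have key : ∀ n : ℕ, ∀ x y : ℝ, |x - y| ≤ N → 1 ≤ N ^ n * |x - y| →
      |dvW N w x - dvW N w y| ≤ C * |x - y| ^ α - B * |x - y| := by
    have base : ∀ x y : ℝ, |x - y| ≤ N → 1 ≤ |x - y| →
      |dvW N w x - dvW N w y| ≤ C * |x - y| ^ α - B * |x - y| := by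
      intro x y h1 h2
      have h3 : 1 ≤ |x - y| ^ α := Real.one_le_rpow h2 hα.le
      have h4 : C * 1 ≤ C * |x - y| ^ α := by gcongr
      have h5 : B * |x - y| ≤ B * N := by gcongr
      linarith [hMb x y]
    intro n
    induction n with
    | zero => intro x y h1 h2; exact base x y h1 (by simpa using h2)
    | succ n ih =>
      intro x y h1 h2
      by_cases h : 1 ≤ |x - y|
      · exact base x y h1 h
      push Not at h
      have e : |(N:ℝ) * x - N * y| = N * |x - y| := by rw [← mul_sub, abs_mul, abs_of_pos hN0]
      have := ih (N * x) (N * y) (by rw [e]; nlinarith) (by rw [e]; rw [pow_succ] at h2; linarith)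
      rw [e, Real.mul_rpow hN0.le (abs_nonneg _)] at this
      rw [dvW_self N w hw0 hN hwN x, dvW_self N w hw0 hN hwN y]
      have h5 := aux_sin_sub (2 * π * x) (2 * π * y)
      rw [← mul_sub, abs_mul, abs_of_pos (by positivity : 0 < 2 * π)] at h5
      calc _ = |(-(2 * π)) * (sin (2 * π * x) - sin (2 * π * y)) +
            (w * N) * (dvW N w (N * x) - dvW N w (N * y))| := by congr 1; ring
        _ ≤ 2 * π * |sin (2 * π * x) - sin (2 * π * y)| +
            (w * N) * |dvW N w (N * x) - dvW N w (N * y)| := by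
            refine (abs_add_le _ _).trans (le_of_eq ?_)
            rw [abs_mul, abs_mul, abs_neg, abs_of_pos (by positivity : 0 < 2 * π),
              abs_of_pos (by positivity : 0 < w * N)]
        _ ≤ 2 * π * (2 * π * |x - y|) +
            (w * N) * (C * (N ^ α * |x - y| ^ α) - B * (N * |x - y|)) := by gcongr
        _ = C * |x - y| ^ α * (w * N * N ^ α) + (4 * π ^ 2 - B * l) * |x - y| := by
            rw [hl]; ring
        _ = _ := by rw [hθ, hBe]; ring
  refine ⟨C, hC0, fun x y => ?_⟩
  rcases eq_or_lt_of_le (abs_nonneg (x - y)) with h | h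
  · have : x = y := by linarith [abs_eq_zero.1 h.symm]
    subst this
    simp [Real.zero_rpow hα.ne']
  by_cases h1 : 1 ≤ |x - y|
  · have h3 : 1 ≤ |x - y| ^ α := Real.one_le_rpow h1 hα.le
    have h4 : C * 1 ≤ C * |x - y| ^ α := by gcongr
    have : 0 < B * N := by positivity
    linarith [hMb x y]
  · push Not at h1
    obtain ⟨n, hn⟩ := pow_unbounded_of_one_lt (|x - y|⁻¹) (by exact_mod_cast hN2 : (1:ℝ) < N)
    have := key n x y (by linarith) (by
      have := mul_lt_mul_of_pos_right hn h
      rw [inv_mul_cancel₀ h.ne'] at this; exact this.le)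
    have : 0 < B * |x - y| := by positivity
    linarith

lemma oneD (α : ℝ) (hα0 : 0 < α) (hα1 : α < 1) (ε : ℝ) (hε : 0 < ε) :
    ∃ N : ℕ, 4 ≤ N ∧ ∃ F F' : ℝ → ℝ, (∀ x, HasDerivAt F (F' x) x) ∧
      (∃ C : ℝ, 0 < C ∧ ∀ x y : ℝ, |F' x - F' y| ≤ C * |x - y| ^ α) ∧
      (∃ L : NNReal, LipschitzWith L F) ∧
      ∀ k z : ℕ, ∃ a b : ℝ, ∀ t ∈ Icc (0:ℝ) 1,
        |((N:ℝ) ^ k) ^ (1 + α) * F ((z + t) / N ^ k) - cos (2 * π * t) - (a + b * t)| ≤ ε := by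
  have t1 : Filter.Tendsto (fun N : ℕ => (N:ℝ) ^ (-(1 + α))) Filter.atTop (nhds 0) :=
    (tendsto_rpow_neg_atTop (by linarith)).comp tendsto_natCast_atTop_atTop
  have t2 : Filter.Tendsto (fun N : ℕ => (N:ℝ) ^ (1 - α)) Filter.atTop Filter.atTop :=
    (tendsto_rpow_atTop (by linarith)).comp tendsto_natCast_atTop_atTop
  have s1 := t1.eventually (gt_mem_nhds (by positivity : 0 < min (1/2) (ε / 4)))
  have s2 := t2.eventually (Filter.eventually_gt_atTop (1 + 16 * π ^ 2 / ε))
  obtain ⟨N, h1, h2, h4⟩ := (s1.and (s2.and (Filter.eventually_ge_atTop 4))).exists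
  have hN0 : (0:ℝ) < N := by exact_mod_cast (by omega : 0 < N)
  have hN1 : (1:ℝ) < N := by exact_mod_cast (by omega : 1 < N)
  set w := (N:ℝ) ^ (-(1 + α)) with hw
  have hw0 : 0 < w := by positivity
  have e1 : w * N = (N:ℝ) ^ (-α) := by
    rw [hw]; nth_rewrite 2 [← Real.rpow_one (N:ℝ)]; rw [← Real.rpow_add hN0]; congr 1; ring
  have e2 : w * N ^ 2 = (N:ℝ) ^ (1 - α) := by
    rw [hw, ← Real.rpow_natCast, ← Real.rpow_add hN0]; congr 1; push_cast; ring
  have hwN : w * N < 1 := by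
    rw [e1]; exact Real.rpow_lt_one_of_one_lt_of_neg hN1 (by linarith)
  have hθ : w * N * (N:ℝ) ^ α = 1 := by rw [e1, ← Real.rpow_add hN0]; simp
  rw [← e2] at h2
  have hq : 0 < 16 * π ^ 2 / ε := by positivity
  have hlam : 1 < w * N ^ 2 := by linarith
  refine ⟨N, h4, vW N w, dvW N w, vW_hasDerivAt N w hw0 (by omega) hwN,
    vW_holder N w hw0 (by omega) hwN α hα0 hθ hlam (by omega), ?_, ?_⟩
  · refine ⟨(2 * π * (1 - w * N)⁻¹).toNNReal, ?_⟩
    have hd := vW_hasDerivAt N w hw0 (by omega) hwN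
    refine lipschitzWith_of_nnnorm_deriv_le (fun x => (hd x).differentiableAt) (fun x => ?_)
    rw [(hd x).deriv, ← NNReal.coe_le_coe]
    have := dvW_abs_le N w hw0 (by omega) hwN x
    exact this.trans (Real.le_coe_toNNReal _)
  · intro k z
    obtain ⟨a, b, h⟩ := vW_approx N w hw0 (by omega) hwN hlam k z
    refine ⟨a, b, fun t ht => ?_⟩
    have e3 : ((N:ℝ) ^ k) ^ (1 + α) = (w ^ k)⁻¹ := by
      rw [hw, ← inv_pow, ← Real.rpow_neg hN0.le, neg_neg, ← Real.rpow_natCast, ← Real.rpow_natCast,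
        ← Real.rpow_mul hN0.le, ← Real.rpow_mul hN0.le, mul_comm]
    rw [e3]
    refine (h t ht).trans ?_
    have f1 : w < 1/2 := h1.trans_le (min_le_left _ _)
    have f2 : w < ε/4 := h1.trans_le (min_le_right _ _)
    have f3 : w / (1 - w) ≤ ε / 2 := by
      rw [div_le_iff₀ (by linarith)]; nlinarith
    have f4 : 8 * π ^ 2 * ((1 - ((w * N ^ 2) ^ k)⁻¹) / (w * N ^ 2 - 1)) ≤ ε / 2 := by
      have : (1 - ((w * (N:ℝ) ^ 2) ^ k)⁻¹) / (w * N ^ 2 - 1) ≤ 1 / (16 * π ^ 2 / ε) := by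
        gcongr
        · have : 0 < ((w * (N:ℝ) ^ 2) ^ k)⁻¹ := by positivity
          linarith
        · linarith
      calc _ ≤ 8 * π ^ 2 * (1 / (16 * π ^ 2 / ε)) := by gcongr
        _ = _ := by field_simp; norm_num
    linarith


abbrev diffMat (m : ℕ) (u : Fin (m + 2) → Fin (m + 1) → ℝ) : Matrix (Fin (m + 1)) (Fin (m + 1)) ℝ :=
  Matrix.of fun i j => u i.succ j - u 0 j

lemma simplex_vol_s18 (m : ℕ) : ∃ s : ℝ, 0 < s ∧
    ∀ x : Fin (m + 2) → EuclideanSpace ℝ (Fin (m + 1)),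
      (μH[(m + 1 : ℝ)] (convexHull ℝ (Set.range x))).toReal
        = s * |(diffMat m (fun i j => x i j)).det| := by
  have hd : ((m:ℝ) + 1) = ((Module.finrank ℝ (EuclideanSpace ℝ (Fin (m + 1))) : ℕ) : ℝ) := by
    simp
  rw [hd]
  have := isAddHaarMeasure_hausdorffMeasure (E := EuclideanSpace ℝ (Fin (m + 1)))
  set μ : Measure (EuclideanSpace ℝ (Fin (m + 1))) :=
    μH[((Module.finrank ℝ (EuclideanSpace ℝ (Fin (m + 1))) : ℕ) : ℝ)] with hμ
  let T : Fin (m + 2) → EuclideanSpace ℝ (Fin (m + 1)) :=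
    Fin.cons 0 (fun i => EuclideanSpace.single i (1:ℝ))
  have hTspan : affineSpan ℝ (Set.range T) = ⊤ := by
    rw [AffineSubspace.affineSpan_eq_top_iff_vectorSpan_eq_top_of_nonempty _ _ _ (range_nonempty T),
      vectorSpan_eq_span_vsub_set_right ℝ (mem_range_self (0 : Fin (m+2)))]
    rw [eq_top_iff, ← (EuclideanSpace.basisFun (Fin (m+1)) ℝ).toBasis.span_eq]
    apply Submodule.span_mono
    rintro _ ⟨i, rfl⟩
    refine ⟨T i.succ, mem_range_self _, ?_⟩
    simp [T]
  have hpos : 0 < μ (convexHull ℝ (Set.range T)) := by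
    have := interior_convexHull_nonempty_iff_affineSpan_eq_top.2 hTspan
    exact Measure.measure_pos_of_nonempty_interior μ this
  have hfin : μ (convexHull ℝ (Set.range T)) < ⊤ :=
    (isBounded_convexHull.2 (Set.finite_range T).isBounded).measure_lt_top
  refine ⟨(μ (convexHull ℝ (Set.range T))).toReal, ENNReal.toReal_pos hpos.ne' hfin.ne, fun x => ?_⟩
  set M := diffMat m (fun i j => x i j) with hM
  set L := Matrix.toEuclideanLin M.transpose with hL
  have hx : ∀ i, x i = x 0 + L (T i) := by
    intro i
    refine Fin.cases ?_ (fun i => ?_) i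
    · simp [T]
    · ext j
      simp [T, hL, hM, Matrix.toEuclideanLin, Matrix.mulVec_single]
  let A : EuclideanSpace ℝ (Fin (m + 1)) →ᵃ[ℝ] EuclideanSpace ℝ (Fin (m + 1)) :=
    AffineMap.const ℝ _ (x 0) + L.toAffineMap
  have hA : ∀ v, A v = x 0 + L v := fun v => rfl
  have hr : Set.range x = A '' Set.range T := by
    rw [← Set.range_comp]; congr 1; ext1 i; rw [Function.comp, hA, ← hx]
  have hdet : LinearMap.det L = M.det := by
    rw [hL, Matrix.toEuclideanLin_eq_toLin_orthonormal, LinearMap.det_toLin, Matrix.det_transpose]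
  rw [hr, ← AffineMap.image_convexHull]
  have : A '' (convexHull ℝ (Set.range T)) =
      (fun v => x 0 + v) '' (L '' (convexHull ℝ (Set.range T))) := by
    rw [Set.image_image]; rfl
  rw [this, Set.image_add_left, measure_preimage_add, Measure.addHaar_image_linearMap, hdet,
    ENNReal.toReal_mul, ENNReal.toReal_ofReal (abs_nonneg _), mul_comm]

/-- base points in the cube -/
noncomputable def baseY (m : ℕ) (hm : 0 < m) : Fin (m + 2) → Fin m → ℝ :=
  Fin.cons (fun _ => 1/4) (Fin.snoc (α := fun _ => Fin m → ℝ)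
    (fun j l => if l = j then 3/4 else 1/4)
    (fun l => if l = ⟨0, hm⟩ then 1/2 else 1/4))

lemma baseY_mem (m : ℕ) (hm : 0 < m) (i l) : 1/4 ≤ baseY m hm i l ∧ baseY m hm i l ≤ 3/4 := by
  unfold baseY
  refine Fin.cases ?_ (fun i => ?_) i
  · norm_num
  · refine Fin.lastCases ?_ (fun j => ?_) i
    · simp only [Fin.cons_succ, Fin.snoc_last]; split_ifs <;> norm_num
    · simp only [Fin.cons_succ, Fin.snoc_castSucc]; split_ifs <;> norm_num

noncomputable def baseU (m : ℕ) (hm : 0 < m) (i : Fin (m + 2)) : Fin (m + 1) → ℝ :=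
  Fin.snoc (α := fun _ => ℝ) (baseY m hm i) (cos (2 * π * baseY m hm i ⟨0, hm⟩))

lemma baseU_det (m : ℕ) (hm : 0 < m) : (diffMat m (baseU m hm)).det ≠ 0 := by
  have c1 : cos (2 * π * (1/4)) = 0 := by rw [show 2 * π * (1/4) = π / 2 by ring]; simp
  have c2 : cos (2 * π * (3/4)) = 0 := by
    rw [show 2 * π * (3/4) = π / 2 + π by ring, Real.cos_add_pi]; simp
  have c3 : cos (2 * π * (1/2)) = -1 := by rw [show 2 * π * (1/2) = π by ring]; simp
  have e1 : ∀ (j l : Fin m), diffMat m (baseU m hm) j.castSucc l.castSucc = if l = j then 1/2 else 0 := by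
    intro j l
    simp only [diffMat, Matrix.of_apply, baseU, baseY, Fin.cons_succ, Fin.snoc_castSucc, Fin.cons_zero]
    split_ifs <;> norm_num
  have e2 : ∀ (j : Fin m), diffMat m (baseU m hm) j.castSucc (Fin.last m) = 0 := by
    intro j
    simp only [diffMat, Matrix.of_apply, baseU, baseY, Fin.cons_succ, Fin.snoc_castSucc, Fin.cons_zero,
      Fin.snoc_last]
    split_ifs
    · rw [c1, c2]; norm_num
    · rw [c1]; norm_num
  have e3 : diffMat m (baseU m hm) (Fin.last m) (Fin.last m) = -1 := by
    simp only [diffMat, Matrix.of_apply, baseU, baseY, Fin.cons_succ, Fin.snoc_castSucc, Fin.cons_zero,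
      Fin.snoc_last]
    rw [if_pos trivial, c1, c3]; norm_num
  rw [Matrix.det_of_isLowerTriangular, Fin.prod_univ_castSucc, e3]
  · simp only [e1]
    simp
  · intro i j
    refine Fin.lastCases ?_ (fun i => ?_) i <;> refine Fin.lastCases ?_ (fun j => ?_) j
    · intro h; exact absurd h (lt_irrefl _)
    · intro h; exact absurd (OrderDual.toDual_lt_toDual.1 h) (not_lt.2 (Fin.le_last _))
    · intro _; exact e2 i
    · intro h
      rw [e1, if_neg]
      rintro rfl; exact absurd h (lt_irrefl _)

/-- robust lower bound for the determinant near the base configuration -/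
lemma det_robust (m : ℕ) (hm : 0 < m) : ∃ c δ : ℝ, 0 < c ∧ 0 < δ ∧
    ∀ u : Fin (m + 2) → Fin (m + 1) → ℝ, (∀ i j, |u i j - baseU m hm i j| ≤ δ) →
      c ≤ |(diffMat m u).det| := by
  have hc : Continuous fun u : Fin (m + 2) → Fin (m + 1) → ℝ => |(diffMat m u).det| := by
    refine continuous_abs.comp (Continuous.matrix_det ?_)
    refine continuous_matrix fun i j => ?_
    simp only [diffMat, Matrix.of_apply]
    fun_prop
  have h0 : 0 < |(diffMat m (baseU m hm)).det| := abs_pos.2 (baseU_det m hm)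
  have := (hc.tendsto (baseU m hm)).eventually (lt_mem_nhds (half_lt_self h0))
  obtain ⟨δ, hδ, h⟩ := Metric.nhds_basis_closedBall.eventually_iff.1 this
  refine ⟨_, δ, half_pos h0, hδ, fun u hu => (h ?_).le⟩
  rw [Metric.mem_closedBall]
  refine (dist_pi_le_iff hδ.le).2 fun i => (dist_pi_le_iff hδ.le).2 fun j => hu i j

lemma det_scale (m : ℕ) (hm : 0 < m) (u x : Fin (m + 2) → Fin (m + 1) → ℝ) (r q a b : ℝ)
    (z : Fin m → ℝ)
    (h1 : ∀ i (j : Fin m), x i j.castSucc = r * (z j + u i j.castSucc))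
    (h2 : ∀ i, x i (Fin.last m) = q * (u i (Fin.last m) + (a + b * u i (Fin.castSucc ⟨0, hm⟩)))) :
    (diffMat m x).det = r ^ m * q * (diffMat m u).det := by
  have hne : Fin.last m ≠ Fin.castSucc ⟨0, hm⟩ := (Fin.castSucc_lt_last _).ne'
  rw [← Matrix.det_updateCol_add_smul_self (diffMat m u) hne b]
  have : r ^ m * q = ∏ i : Fin (m+1), (Fin.snoc (α := fun _ => ℝ) (fun _ : Fin m => r) q : Fin (m+1) → ℝ) i := by
    rw [Fin.prod_univ_castSucc]; simp
  rw [this, ← Matrix.det_mul_row]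
  congr 1
  ext i j
  refine Fin.lastCases ?_ (fun j => ?_) j
  · simp [Matrix.updateCol_apply, h2]; ring
  · simp [Matrix.updateCol_apply, h1, (Fin.castSucc_lt_last j).ne]; ring

lemma graphMap_castSucc (m : ℕ) (hm : 0 < m) (F : ℝ → ℝ) (x : Fin m → ℝ) (j : Fin m) :
    graphMap m hm F x j.castSucc = x j := by
  change (Fin.snoc (α := fun _ => ℝ) x (F (x ⟨0, hm⟩)) : Fin (m+1) → ℝ) j.castSucc = x j
  simp

lemma graphMap_last (m : ℕ) (hm : 0 < m) (F : ℝ → ℝ) (x : Fin m → ℝ) :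
    graphMap m hm F x (Fin.last m) = F (x ⟨0, hm⟩) := by
  change (Fin.snoc (α := fun _ => ℝ) x (F (x ⟨0, hm⟩)) : Fin (m+1) → ℝ) (Fin.last m) = _
  simp

lemma graphMap_lipschitz (m : ℕ) (hm : 0 < m) (F : ℝ → ℝ) (L : NNReal) (hF : LipschitzWith L F) :
    ∃ K : NNReal, 1 ≤ K ∧ LipschitzWith K (graphMap m hm F) := by
  have h1 : LipschitzWith (max 1 L)
      (fun x : Fin m → ℝ => (Fin.snoc (α := fun _ => ℝ) x (F (x ⟨0, hm⟩)) : Fin (m+1) → ℝ)) := by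
    refine LipschitzWith.of_dist_le_mul fun x y => ?_
    refine (dist_pi_le_iff (by positivity)).2 fun j => ?_
    refine Fin.lastCases ?_ (fun j => ?_) j
    · simp only [Fin.snoc_last]
      refine (hF.dist_le_mul _ _).trans ?_
      gcongr
      · exact le_max_right _ _
      · exact dist_le_pi_dist x y _
    · simp only [Fin.snoc_castSucc]
      refine (dist_le_pi_dist x y j).trans ?_
      refine le_mul_of_one_le_left dist_nonneg ?_
      exact_mod_cast le_max_left 1 L
  have h2 := (EuclideanSpace.equiv (Fin (m + 1)) ℝ).symm.lipschitz.comp h1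
  exact ⟨max 1 _, le_max_left _ _, h2.weaken (le_max_right _ _)⟩

lemma curv_lower_s18 (m : ℕ) (hm : 0 < m) (p α : ℝ) (hp0 : 0 < p) (hα : (1 - α) * p = m * (m + 1))
    (s c δ₀ δ : ℝ) (hs : 0 < s)
    (hvol : ∀ x : Fin (m + 2) → EuclideanSpace ℝ (Fin (m + 1)),
      (μH[(m + 1 : ℝ)] (convexHull ℝ (Set.range x))).toReal
        = s * |(diffMat m (fun i j => x i j)).det|)
    (hc : 0 < c)
    (hrob : ∀ u : Fin (m + 2) → Fin (m + 1) → ℝ, (∀ i j, |u i j - baseU m hm i j| ≤ δ₀) →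
      c ≤ |(diffMat m u).det|)
    (hδ1 : δ ≤ 1 / 16) (hδ2 : δ ≤ δ₀) (hδ3 : 2 * π * δ ≤ δ₀ / 2)
    (n : ℝ) (hn : 0 < n) (F : ℝ → ℝ) (K : NNReal) (hK1 : 1 ≤ K)
    (hK : LipschitzWith K (graphMap m hm F))
    (z : Fin m → ℝ) (a b : ℝ) (hab : ∀ t ∈ Icc (0:ℝ) 1,
        |n ^ (1 + α) * F ((z ⟨0, hm⟩ + t) / n) - cos (2 * π * t) - (a + b * t)| ≤ δ₀ / 2)
    (Y : Fin (m + 2) → Fin m → ℝ) (hY : ∀ i l, |Y i l - baseY m hm i l| ≤ δ) :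
    (s * c / K ^ (m + 2)) ^ p * n ^ (m * (m + 1)) ≤
      discreteCurv m (fun i => graphMap m hm F (fun l => (z l + Y i l) / n)) ^ p := by
  have hY01 : ∀ i l, 0 ≤ Y i l ∧ Y i l ≤ 1 := by
    intro i l
    have h1 := abs_le.1 (hY i l)
    have h2 := baseY_mem m hm i l
    constructor <;> linarith
  set x : Fin (m + 2) → EuclideanSpace ℝ (Fin (m + 1)) :=
    fun i => graphMap m hm F (fun l => (z l + Y i l) / n) with hx
  let u : Fin (m + 2) → Fin (m + 1) → ℝ := fun i => Fin.snoc (α := fun _ => ℝ) (Y i)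
    (n ^ (1 + α) * F ((z ⟨0, hm⟩ + Y i ⟨0, hm⟩) / n) - (a + b * Y i ⟨0, hm⟩))
  have hu : c ≤ |(diffMat m u).det| := by
    apply hrob
    intro i j
    refine Fin.lastCases ?_ (fun j => ?_) j
    · simp only [u, baseU, Fin.snoc_last]
      have h1 := hab _ (hY01 i ⟨0, hm⟩)
      have h2 : |cos (2 * π * Y i ⟨0, hm⟩) - cos (2 * π * baseY m hm i ⟨0, hm⟩)| ≤ δ₀ / 2 := by
        refine (Real.abs_cos_sub_cos_le _ _).trans ?_
        rw [← mul_sub, abs_mul, abs_of_pos (by positivity : 0 < 2 * π)]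
        refine le_trans ?_ hδ3
        gcongr
        exact hY i _
      rw [abs_le] at *
      constructor <;> linarith [h1.1, h1.2, h2.1, h2.2]
    · simp only [u, baseU, Fin.snoc_castSucc]
      exact (hY i j).trans hδ2
  have hdet := det_scale m hm u (fun i j => x i j) n⁻¹ (n ^ (-(1 + α))) a b z
    (by intro i j; simp only [hx, u, graphMap_castSucc, Fin.snoc_castSucc]; rw [div_eq_inv_mul])
    (by
      intro i
      simp only [hx, u, graphMap_last, Fin.snoc_castSucc, Fin.snoc_last]
      rw [sub_add_cancel, ← mul_assoc, ← Real.rpow_add hn]; simp)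
  have hV : s * (n⁻¹ ^ m * n ^ (-(1 + α)) * c) ≤
      (μH[(m + 1 : ℝ)] (convexHull ℝ (Set.range x))).toReal := by
    rw [hvol, hdet, abs_mul, abs_of_pos (by positivity : 0 < n⁻¹ ^ m * n ^ (-(1 + α)))]
    gcongr
  have hdist : ∀ i j, dist (x i) (x j) ≤ K * n⁻¹ := by
    intro i j
    refine (hK.dist_le_mul _ _).trans ?_
    gcongr
    refine (dist_pi_le_iff (by positivity)).2 fun l => ?_
    rw [Real.dist_eq, ← sub_div, add_sub_add_left_eq_sub, abs_div, abs_of_pos hn, div_eq_mul_inv]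
    refine mul_le_of_le_one_left (by positivity) ?_
    have h1 := hY01 i l
    have h2 := hY01 j l
    rw [abs_le]; constructor <;> linarith
  have hdiam : Metric.diam (Set.range x) ≤ K * n⁻¹ := by
    refine Metric.diam_le_of_forall_dist_le (by positivity) ?_
    rintro _ ⟨i, rfl⟩ _ ⟨j, rfl⟩
    exact hdist i j
  have hKpos : (0:ℝ) < K := by exact_mod_cast (zero_lt_one.trans_le hK1)
  have hdpos : 0 < Metric.diam (Set.range x) := by
    have hb : Bornology.IsBounded (Set.range x) := (Set.finite_range x).isBounded
    by_contra hcon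
    have h0 : Metric.diam (Set.range x) = 0 := le_antisymm (not_lt.1 hcon) Metric.diam_nonneg
    have hall : ∀ i, x i = x 0 := fun i => by
      have := Metric.dist_le_diam_of_mem hb (mem_range_self i) (mem_range_self 0)
      rw [h0] at this
      exact dist_le_zero.1 this
    have : (diffMat m (fun i j => x i j)).det = 0 := by
      have : diffMat m (fun i j => x i j) = 0 := by
        ext i j; simp only [diffMat, Matrix.of_apply, hall, sub_self, Matrix.zero_apply]
      rw [this, Matrix.det_zero]
    have h3 := hvol x
    rw [this] at h3
    simp only [abs_zero, mul_zero] at h3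
    have : 0 < s * (n⁻¹ ^ m * n ^ (-(1 + α)) * c) := by positivity
    linarith
  have hcurv : s * c / K ^ (m + 2) * n ^ (1 - α) ≤ discreteCurv m x := by
    unfold discreteCurv
    calc _ = s * (n⁻¹ ^ m * n ^ (-(1 + α)) * c) / (K * n⁻¹) ^ (m + 2) := by
          have : n ^ (1 - α) = n ^ (-(1 + α)) * n ^ 2 := by
            rw [← Real.rpow_natCast n 2, ← Real.rpow_add hn]; congr 1; push_cast; ring
          rw [this, mul_pow, pow_add n⁻¹]
          field_simp
      _ ≤ _ := by gcongr
  calc _ = (s * c / K ^ (m + 2) * n ^ (1 - α)) ^ p := by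
        rw [Real.mul_rpow (by positivity) (by positivity), ← Real.rpow_mul hn.le, hα]
        congr 1
        rw [← Real.rpow_natCast]; congr 1; push_cast; ring
    _ ≤ _ := by gcongr

lemma box_disjoint_aux (N : ℕ) (hN : 4 ≤ N) (k k' : ℕ) (hlt : k < k') (t₀ t₁ : ℝ)
    (h1 : 1/8 ≤ (N:ℝ) ^ k * (t₁ - t₀)) (h2 : (N:ℝ) ^ k' * (t₁ - t₀) ≤ 3/8) : False := by
  have hNr : (4:ℝ) ≤ N := by exact_mod_cast hN
  have hpos : 0 < (N:ℝ) ^ k := by positivity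
  have ht : 0 < t₁ - t₀ := by
    by_contra h
    push Not at h
    nlinarith
  have : (N:ℝ) ^ (k + 1) ≤ N ^ k' := pow_le_pow_right₀ (by linarith) hlt
  have h3 : (N:ℝ) ^ (k + 1) * (t₁ - t₀) ≤ N ^ k' * (t₁ - t₀) := by gcongr
  rw [pow_succ] at h3
  nlinarith

noncomputable def projE (m : ℕ) (y : EuclideanSpace ℝ (Fin (m + 1))) : Fin m → ℝ :=
  fun l => y l.castSucc

lemma projE_lipschitz (m : ℕ) : LipschitzWith 1 (projE m) := by
  refine LipschitzWith.of_dist_le_mul fun x y => ?_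
  rw [NNReal.coe_one, one_mul]
  refine (dist_pi_le_iff dist_nonneg).2 fun j => ?_
  have := PiLp.norm_apply_le (x - y) j.castSucc
  rw [dist_eq_norm, dist_eq_norm]
  exact this

noncomputable def boxQ (m : ℕ) (hm : 0 < m) (δ n : ℝ) (z : Fin m → ℕ) (i : Fin (m + 2)) :
    Set (Fin m → ℝ) :=
  Icc (fun l => (z l + (baseY m hm i l - δ)) / n) (fun l => (z l + (baseY m hm i l + δ)) / n)

lemma boxQ_mem (m : ℕ) (hm : 0 < m) (δ n : ℝ) (hn : 0 < n) (z : Fin m → ℕ) (i : Fin (m + 2))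
    (x : Fin m → ℝ) (hx : x ∈ boxQ m hm δ n z i) (l : Fin m) :
    |n * x l - z l - baseY m hm i l| ≤ δ := by
  have h1 := hx.1 l
  have h2 := hx.2 l
  simp only at h1 h2
  rw [div_le_iff₀ hn] at h1
  rw [le_div_iff₀ hn] at h2
  rw [abs_le]; constructor <;> linarith

lemma boxQ_volume (m : ℕ) (hm : 0 < m) (δ n : ℝ) (z : Fin m → ℕ) (i : Fin (m + 2)) :
    volume (boxQ m hm δ n z i) = ENNReal.ofReal (2 * δ / n) ^ m := by
  unfold boxQ
  rw [Real.volume_Icc_pi]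
  have : ∀ l, (z l + (baseY m hm i l + δ)) / n - (z l + (baseY m hm i l - δ)) / n = 2 * δ / n := by
    intro l; ring
  simp only [this]
  simp

lemma boxQ_sub (m : ℕ) (hm : 0 < m) (δ : ℝ) (hδ1 : δ ≤ 1 / 16) (n : ℕ) (hn : 0 < n)
    (z : Fin m → Fin n) (i : Fin (m + 2)) (x : Fin m → ℝ)
    (hx : x ∈ boxQ m hm δ n (fun l => z l) i) (l : Fin m) : x l ∈ Icc (0:ℝ) 1 := by
  have hnr : (0:ℝ) < n := by exact_mod_cast hn
  have h1 := abs_le.1 (boxQ_mem m hm δ n hnr _ i x hx l)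
  have h2 := baseY_mem m hm i l
  have h3 : ((z l : ℕ) : ℝ) + 1 ≤ n := by exact_mod_cast (z l).2
  have h4 : (0:ℝ) ≤ ((z l : ℕ) : ℝ) := by positivity
  constructor <;> nlinarith [h1.1, h1.2]

lemma main_energy (m : ℕ) (hm : 0 < m) (p α : ℝ) (hp0 : 0 < p) (hα : (1 - α) * p = m * (m + 1))
    (s c δ₀ δ : ℝ) (hs : 0 < s)
    (hvol : ∀ x : Fin (m + 2) → EuclideanSpace ℝ (Fin (m + 1)),
      (μH[(m + 1 : ℝ)] (convexHull ℝ (Set.range x))).toReal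
        = s * |(diffMat m (fun i j => x i j)).det|)
    (hc : 0 < c)
    (hrob : ∀ u : Fin (m + 2) → Fin (m + 1) → ℝ, (∀ i j, |u i j - baseU m hm i j| ≤ δ₀) →
      c ≤ |(diffMat m u).det|)
    (hδ : 0 < δ) (hδ1 : δ ≤ 1 / 16) (hδ2 : δ ≤ δ₀) (hδ3 : 2 * π * δ ≤ δ₀ / 2)
    (N : ℕ) (hN : 4 ≤ N) (F : ℝ → ℝ) (L : NNReal) (hL : LipschitzWith L F)
    (hab : ∀ k z : ℕ, ∃ a b : ℝ, ∀ t ∈ Icc (0:ℝ) 1,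
        |((N:ℝ) ^ k) ^ (1 + α) * F ((z + t) / N ^ k) - cos (2 * π * t) - (a + b * t)| ≤ δ₀ / 2) :
    curvEnergy m p
          {y : EuclideanSpace ℝ (Fin (m + 1)) |
            ∃ x : Fin m → ℝ, (∀ i, x i ∈ Set.Icc (0 : ℝ) 1) ∧ y = graphMap m hm F x}
        = ⊤ := by
  obtain ⟨K, hK1, hK⟩ := graphMap_lipschitz m hm F L hL
  have hKpos : (0:ℝ) < K := by exact_mod_cast (zero_lt_one.trans_le hK1)
  set S := {y : EuclideanSpace ℝ (Fin (m + 1)) |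
            ∃ x : Fin m → ℝ, (∀ i, x i ∈ Set.Icc (0 : ℝ) 1) ∧ y = graphMap m hm F x} with hS
  have hSim : S = graphMap m hm F '' (Icc (fun _ => 0) (fun _ => 1)) := by
    ext y
    constructor
    · rintro ⟨x, hx, rfl⟩
      exact ⟨x, ⟨fun i => (hx i).1, fun i => (hx i).2⟩, rfl⟩
    · rintro ⟨x, hx, rfl⟩
      exact ⟨x, fun i => ⟨hx.1 i, hx.2 i⟩, rfl⟩
  have hSmeas : MeasurableSet S := by
    rw [hSim]
    exact (isCompact_Icc.image hK.continuous).isClosed.measurableSet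
  have hHpi : (μH[(m:ℝ)] : Measure (Fin m → ℝ)) = volume := by
    have := hausdorffMeasure_pi_real (ι := Fin m)
    rwa [Fintype.card_fin] at this
  have hSfin : μH[(m:ℝ)] S < ⊤ := by
    rw [hSim]
    refine (hK.hausdorffMeasure_image_le (by positivity) _).trans_lt ?_
    rw [hHpi]
    refine ENNReal.mul_lt_top ?_ isCompact_Icc.measure_lt_top
    exact ENNReal.rpow_lt_top_of_nonneg (by positivity) ENNReal.coe_ne_top
  set μ : Measure (EuclideanSpace ℝ (Fin (m + 1))) := μH[(m : ℝ)].restrict S with hμ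
  have hfm : IsFiniteMeasure μ := ⟨by rw [hμ, Measure.restrict_apply_univ]; exact hSfin⟩
  have hn : ∀ k, (0:ℝ) < (N:ℝ) ^ k := fun k => by
    have : (0:ℝ) < N := by exact_mod_cast (by omega : 0 < N)
    positivity
  let A : (k : ℕ) → (Fin m → Fin (N ^ k)) → Fin (m + 2) → Set (EuclideanSpace ℝ (Fin (m + 1))) :=
    fun k z i => S ∩ projE m ⁻¹' (boxQ m hm δ ((N:ℝ) ^ k) (fun l => z l) i)
  have hAmeas : ∀ k z i, MeasurableSet (A k z i) := fun k z i =>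
    hSmeas.inter ((isClosed_Icc.preimage (projE_lipschitz m).continuous).measurableSet)
  have hAvol : ∀ k z i, ENNReal.ofReal (2 * δ / (N:ℝ) ^ k) ^ m ≤ μ (A k z i) := by
    intro k z i
    rw [hμ, Measure.restrict_apply (hAmeas k z i), ← boxQ_volume m hm δ _ (fun l => z l) i, ← hHpi]
    have h1 := (projE_lipschitz m).hausdorffMeasure_image_le (d := m) (by positivity) (A k z i ∩ S)
    rw [ENNReal.coe_one, ENNReal.one_rpow, one_mul] at h1
    refine le_trans (measure_mono ?_) h1
    intro x hx
    have hx01 := boxQ_sub m hm δ hδ1 (N ^ k) (by positivity) z i x (by push_cast; exact hx)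
    have e : projE m (graphMap m hm F x) = x := by
      ext l; exact graphMap_castSucc m hm F x l
    have hSx : graphMap m hm F x ∈ S := ⟨x, hx01, rfl⟩
    refine ⟨graphMap m hm F x, ⟨⟨hSx, ?_⟩, hSx⟩, e⟩
    rw [mem_preimage, e]; exact hx
  let I := Σ k : ℕ, (Fin m → Fin (N ^ k))
  let B : I → Set (Fin (m + 2) → EuclideanSpace ℝ (Fin (m + 1))) :=
    fun q => univ.pi (A q.1 q.2)
  have hBmeas : ∀ q, MeasurableSet (B q) := fun q => MeasurableSet.univ_pi (hAmeas q.1 q.2)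
  have hBco : ∀ q : I, ∀ x ∈ B q, ∀ i l,
      |(N:ℝ) ^ q.1 * x i (Fin.castSucc l) - ((q.2 l : ℕ) : ℝ) - baseY m hm i l| ≤ δ := by
    intro q x hx i l
    exact boxQ_mem m hm δ _ (hn q.1) _ i _ (hx i (mem_univ i)).2 l
  have hbase0 : ∀ l, baseY m hm 0 l = 1/4 := fun l => by simp [baseY]
  have hbase1 : baseY m hm (Fin.last (m+1)) ⟨0, hm⟩ = 1/2 := by
    rw [← Fin.succ_last, baseY, Fin.cons_succ, Fin.snoc_last, if_pos rfl]
  have hdiff : ∀ q : I, ∀ x ∈ B q,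
      1/8 ≤ (N:ℝ) ^ q.1 * (x (Fin.last (m+1)) (Fin.castSucc ⟨0, hm⟩) - x 0 (Fin.castSucc ⟨0, hm⟩)) ∧
      (N:ℝ) ^ q.1 * (x (Fin.last (m+1)) (Fin.castSucc ⟨0, hm⟩) - x 0 (Fin.castSucc ⟨0, hm⟩)) ≤ 3/8 := by
    intro q x hx
    have h1 := abs_le.1 (hBco q x hx 0 ⟨0, hm⟩)
    have h2 := abs_le.1 (hBco q x hx (Fin.last (m+1)) ⟨0, hm⟩)
    rw [hbase0] at h1
    rw [hbase1] at h2
    constructor <;> linarith [h1.1, h1.2, h2.1, h2.2]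
  have hBdisj : Pairwise (Function.onFun Disjoint B) := by
    rintro ⟨k, z⟩ ⟨k', z'⟩ hne
    refine Set.disjoint_left.2 fun x hx hx' => hne ?_
    have d1 := hdiff _ x hx
    have d2 := hdiff _ x hx'
    rcases lt_trichotomy k k' with h | h | h
    · exact (box_disjoint_aux N hN k k' h _ _ d1.1 d2.2).elim
    · subst h
      congr 1
      ext l
      have h1 := abs_le.1 (hBco _ x hx 0 l)
      have h2 := abs_le.1 (hBco _ x hx' 0 l)
      simp only at h1 h2
      have h3 : ((z l : ℕ) : ℝ) < ((z' l : ℕ) : ℝ) + 1 := by linarith [h1.1, h1.2, h2.1, h2.2]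
      have h4 : ((z' l : ℕ) : ℝ) < ((z l : ℕ) : ℝ) + 1 := by linarith [h1.1, h1.2, h2.1, h2.2]
      have h5 : (z l : ℕ) < (z' l : ℕ) + 1 := by exact_mod_cast h3
      have h6 : (z' l : ℕ) < (z l : ℕ) + 1 := by exact_mod_cast h4
      omega
    · exact (box_disjoint_aux N hN k' k h _ _ d2.1 d1.2).elim
  set c₂ := (s * c / K ^ (m + 2)) ^ p with hc₂
  have hc₂0 : 0 < c₂ := by positivity
  have hlow : ∀ q : I, ∀ x ∈ B q,
      ENNReal.ofReal (c₂ * ((N:ℝ) ^ q.1) ^ (m * (m + 1))) ≤ ENNReal.ofReal (discreteCurv m x ^ p) := by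
    rintro ⟨k, z⟩ x hx
    apply ENNReal.ofReal_le_ofReal
    obtain ⟨a, b, h⟩ := hab k (z ⟨0, hm⟩)
    have hg := curv_lower_s18 m hm p α hp0 hα s c δ₀ δ hs hvol hc hrob hδ1 hδ2 hδ3 _ (hn k) F K hK1 hK
      (fun l => ((z l : ℕ) : ℝ)) a b h
      (fun i l => (N:ℝ) ^ k * x i (Fin.castSucc l) - ((z l : ℕ) : ℝ))
      (fun i l => hBco _ x hx i l)
    refine hg.trans (le_of_eq ?_)
    congr 2
    ext1 i
    obtain ⟨y, _, hy⟩ := (hx i (mem_univ i)).1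
    rw [hy]
    congr 1
    ext l
    rw [graphMap_castSucc, add_sub_cancel, mul_div_cancel_left₀ _ (hn k).ne']
  have hint : ∀ q : I, ENNReal.ofReal (c₂ * (2 * δ) ^ (m * (m + 2)) / ((N:ℝ) ^ q.1) ^ m) ≤
      ∫⁻ x in B q, ENNReal.ofReal (discreteCurv m x ^ p) ∂(Measure.pi fun _ => μ) := by
    intro q
    have hnq := hn q.1
    calc _ = ENNReal.ofReal (c₂ * ((N:ℝ) ^ q.1) ^ (m * (m + 1))) *
          ∏ _i : Fin (m + 2), ENNReal.ofReal (2 * δ / (N:ℝ) ^ q.1) ^ m := by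
          rw [Finset.prod_const, Finset.card_univ, Fintype.card_fin,
            ← pow_mul (ENNReal.ofReal (2 * δ / (N:ℝ) ^ q.1)),
            ← ENNReal.ofReal_pow (by positivity), ← ENNReal.ofReal_mul (by positivity)]
          congr 1
          rw [div_pow]
          have : ((N:ℝ) ^ q.1) ^ (m * (m + 2)) = ((N:ℝ) ^ q.1) ^ (m * (m + 1)) * ((N:ℝ) ^ q.1) ^ m := by
            rw [← pow_add]; congr 1
          rw [this]
          field_simp
      _ ≤ ENNReal.ofReal (c₂ * ((N:ℝ) ^ q.1) ^ (m * (m + 1))) * (Measure.pi fun _ => μ) (B q) := by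
          rw [Measure.pi_pi]
          gcongr with i
          exact hAvol q.1 q.2 i
      _ = ∫⁻ x in B q, ENNReal.ofReal (c₂ * ((N:ℝ) ^ q.1) ^ (m * (m + 1)))
            ∂(Measure.pi fun _ => μ) := by rw [setLIntegral_const]
      _ ≤ _ := setLIntegral_mono' (hBmeas q) (hlow q)
  unfold curvEnergy
  rw [eq_top_iff]
  calc (⊤ : ℝ≥0∞) = ∑' _k : ℕ, ENNReal.ofReal (c₂ * (2 * δ) ^ (m * (m + 2))) := by
        rw [ENNReal.tsum_const_eq_top_of_ne_zero]
        exact (ENNReal.ofReal_pos.2 (by positivity)).ne'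
    _ = ∑' k : ℕ, ∑' _z : Fin m → Fin (N ^ k),
          ENNReal.ofReal (c₂ * (2 * δ) ^ (m * (m + 2)) / ((N:ℝ) ^ k) ^ m) := by
        congr 1; ext1 k
        rw [tsum_fintype, Finset.sum_const, Finset.card_univ, Fintype.card_fun, Fintype.card_fin,
          Fintype.card_fin, nsmul_eq_mul, ← ENNReal.ofReal_natCast, ← ENNReal.ofReal_mul (by positivity)]
        congr 1
        have := hn k
        push_cast
        field_simp
    _ = ∑' q : I, ENNReal.ofReal (c₂ * (2 * δ) ^ (m * (m + 2)) / ((N:ℝ) ^ q.1) ^ m) :=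
        (ENNReal.tsum_sigma' (fun q : I =>
          ENNReal.ofReal (c₂ * (2 * δ) ^ (m * (m + 2)) / ((N:ℝ) ^ q.1) ^ m))).symm
    _ ≤ ∑' q : I, ∫⁻ x in B q, ENNReal.ofReal (discreteCurv m x ^ p) ∂(Measure.pi fun _ => μ) :=
        ENNReal.tsum_le_tsum hint
    _ = ∫⁻ x in ⋃ q, B q, ENNReal.ofReal (discreteCurv m x ^ p) ∂(Measure.pi fun _ => μ) :=
        (lintegral_iUnion hBmeas hBdisj _).symm
    _ ≤ _ := setLIntegral_le_lintegral _ _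

/-- For `p > m(m+1)` and `α = 1 - m(m+1)/p` there is a `C^{1,α}`
function `F : ℝ → ℝ` such that the `m`-dimensional graph manifold
`Σ = G([0,1]^m) ⊆ ℝ^{m+1}`, `G(x¹,…,xᵐ) = (x¹,…,xᵐ,F(x¹))`, has infinite
integral curvature energy `E_p(Σ) = ∞`. -/
theorem exists_C1alpha_manifold_infinite_energy (m : ℕ) (hm : 0 < m) (p : ℝ)
    (hp : (m : ℝ) * (m + 1) < p) :
    ∃ F F' : ℝ → ℝ,
      (∀ x : ℝ, HasDerivAt F (F' x) x) ∧
      (∃ C : ℝ, 0 < C ∧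
        ∀ x y : ℝ, |F' x - F' y| ≤ C * |x - y| ^ (1 - (m : ℝ) * (m + 1) / p)) ∧
      curvEnergy m p
          {y : EuclideanSpace ℝ (Fin (m + 1)) |
            ∃ x : Fin m → ℝ, (∀ i, x i ∈ Set.Icc (0 : ℝ) 1) ∧ y = graphMap m hm F x}
        = ⊤ := by
  have hmR : (0:ℝ) < m := by exact_mod_cast hm
  have hmm : (0:ℝ) < m * (m + 1) := by positivity
  have hp0 : 0 < p := hmm.trans hp
  set α := 1 - (m : ℝ) * (m + 1) / p with hαdef
  have hα0 : 0 < α := by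
    rw [hαdef, sub_pos, div_lt_one hp0]; exact hp
  have hα1 : α < 1 := by
    have : 0 < (m : ℝ) * (m + 1) / p := by positivity
    linarith
  have hα : (1 - α) * p = m * (m + 1) := by
    rw [hαdef]; field_simp; ring
  obtain ⟨s, hs, hvol⟩ := simplex_vol_s18 m
  obtain ⟨c, δ₀, hc, hδ₀, hrob⟩ := det_robust m hm
  obtain ⟨N, hN, F, F', hF, hH, ⟨L, hL⟩, hab⟩ := oneD α hα0 hα1 (δ₀ / 2) (by positivity)
  refine ⟨F, F', hF, hH, ?_⟩
  have hpi := Real.pi_gt_three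
  have h3 : 2 * π * min (1 / 16) (δ₀ / (4 * π)) ≤ δ₀ / 2 := by
    calc _ ≤ 2 * π * (δ₀ / (4 * π)) := by gcongr; exact min_le_right _ _
      _ = _ := by field_simp; norm_num
  have h4 : 0 < min (1 / 16) (δ₀ / (4 * π)) := by positivity
  exact main_energy m hm p α hp0 hα s c δ₀ (min (1 / 16) (δ₀ / (4 * π))) hs hvol hc hrob
    h4 (min_le_left _ _) (by nlinarith) h3 N hN F L hL hab
end
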